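/- Let u be a Neumann eigenfunction on S_β with eigenvalue μ > 0 and Bessel coefficients c₀, c₁, with u not identically zero, 0 < β < π and β ≠ π/2. Define the leading Bessel coefficient of u to be c₀ if β < π/2 and c₁ if β > π/2. Let ψ ∈ {0, β}, so that L_ψ is parallel to one of the two boundary rays of S_β. Then the leading Bessel coefficient equals 0 if and only if some arc of Z(L_ψu) ends at the vertex 0. -/

import Mathlib

open Complex Filter Set

noncomputable section

/-- The Laplacian of `u : ℂ → ℝ`, via the second iterated Fréchet derivative. -/
def laplacian (u : ℂ → ℝ) (z : ℂ) : ℝ :=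
  iteratedFDeriv ℝ 2 u z ![1, 1] + iteratedFDeriv ℝ 2 u z ![Complex.I, Complex.I]

/-- The closed sector `S_β = {r·e^{iθ} : r ≥ 0, 0 ≤ θ ≤ β}`. -/
def closedSector (β : ℝ) : Set ℂ :=
  {z | ∃ r : ℝ, 0 ≤ r ∧ ∃ θ : ℝ, 0 ≤ θ ∧ θ ≤ β ∧
    z = (r : ℂ) * Complex.exp (Complex.I * (θ : ℂ))}

/-- The open sector `{r·e^{iθ} : r > 0, 0 < θ < β}`. -/
def openSector (β : ℝ) : Set ℂ :=
  {z | ∃ r : ℝ, 0 < r ∧ ∃ θ : ℝ, 0 < θ ∧ θ < β ∧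
    z = (r : ℂ) * Complex.exp (Complex.I * (θ : ℂ))}

/-- A Neumann eigenfunction on the closed sector `S_β` with eigenvalue `μ`:
continuous on `S_β`, smooth up to the boundary away from the vertex `0`,
satisfying `Δu = -μ·u` on the open sector and having vanishing normal
derivative on the two open boundary rays. -/
structure IsSectorNeumannEigenfun (β : ℝ) (u : ℂ → ℝ) (μ : ℝ) : Prop where
  cont : ContinuousOn u (closedSector β)
  smooth : ContDiffOn ℝ (⊤ : ℕ∞) u (closedSector β \ {0})
  eigen : ∀ z ∈ openSector β, laplacian u z = -μ * u z
  neumann_bottom : ∀ r : ℝ, 0 < r →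
    fderivWithin ℝ u (closedSector β) ((r : ℂ)) Complex.I = 0
  neumann_top : ∀ r : ℝ, 0 < r →
    fderivWithin ℝ u (closedSector β) ((r : ℂ) * Complex.exp (Complex.I * (β : ℂ)))
      (Complex.I * Complex.exp (Complex.I * (β : ℂ))) = 0

/-- The Bessel function of the first kind `J_ν`. -/
def besselJ (ν x : ℝ) : ℝ :=
  ∑' k : ℕ, (-1 : ℝ) ^ k * (x / 2) ^ (2 * (k : ℝ) + ν) /
    ((Nat.factorial k : ℝ) * Real.Gamma ((k : ℝ) + ν + 1))

/-- `u` has Bessel coefficients `c₀ = u(0)` and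
`c₁ = lim_{r→0⁺} (u(r) − u(r·e^{iβ}))/(2·J_{π/β}(√μ·r))` at the vertex `0` of `S_β`. -/
def HasBesselCoeffs (β : ℝ) (u : ℂ → ℝ) (μ c₀ c₁ : ℝ) : Prop :=
  u 0 = c₀ ∧
  Tendsto (fun r : ℝ =>
      (u ((r : ℂ)) - u ((r : ℂ) * Complex.exp (Complex.I * (β : ℂ)))) /
        (2 * besselJ (Real.pi / β) (Real.sqrt μ * r)))
    (nhdsWithin 0 (Ioi 0)) (nhds c₁)

/-- The directional derivative `L_ψ u = cos ψ · ∂ₓu + sin ψ · ∂_yu`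
(one-sided derivative within the sector). -/
def Lpsi (β : ℝ) (u : ℂ → ℝ) (ψ : ℝ) (z : ℂ) : ℝ :=
  fderivWithin ℝ u (closedSector β) z
    ((Real.cos ψ : ℂ) + (Real.sin ψ : ℂ) * Complex.I)

/-- The rotational derivative `R_w u (z) = ⟨∇u(z), i·(z − w)⟩`
(one-sided derivative within the sector). -/
def Rrot (β : ℝ) (u : ℂ → ℝ) (w : ℂ) (z : ℂ) : ℝ :=
  fderivWithin ℝ u (closedSector β) z (Complex.I * (z - w))

/-- Some arc of the set `Z` ends at the vertex `0`. -/
def ArcEndsAtZero (Z : Set ℂ) : Prop :=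
  ∃ γ : ℝ → ℂ, ContinuousOn γ (Icc 0 1) ∧ InjOn γ (Icc 0 1) ∧ γ 0 = 0 ∧
    ∀ t ∈ Ioc (0 : ℝ) 1, γ t ∈ Z \ {0}

/-- The one-sided second derivative (Hessian entry) of `u` within `S` at `p`,
in directions `v, w`. -/
def hessWithin (S : Set ℂ) (u : ℂ → ℝ) (p : ℂ) (v w : ℂ) : ℝ :=
  fderivWithin ℝ (fun z => fderivWithin ℝ u S z v) S p w

/-- The determinant of the one-sided Hessian of `u` within `S` at `p`. -/
def hessDet (S : Set ℂ) (u : ℂ → ℝ) (p : ℂ) : ℝ :=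
  hessWithin S u p 1 1 * hessWithin S u p Complex.I Complex.I -
    hessWithin S u p 1 Complex.I * hessWithin S u p Complex.I 1

/-- The entire factor of the Bessel function: `J_m(2√s) = s^(m/2) / Γ(m+1) * besselFactor m s`. -/
def besselFactor (m s : ℝ) : ℝ :=
  ∑' k : ℕ, (-s) ^ k * (Real.Gamma (m + 1) / (k.factorial * Real.Gamma (m + k + 1)))

lemma gamma_le_gamma_add_nat {m : ℝ} (hm : 0 ≤ m) (k : ℕ) :
    Real.Gamma (m + 1) ≤ Real.Gamma (m + k + 1) := by
  induction k with
  | zero => simp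
  | succ k ih =>
    have h : m + ((k + 1 : ℕ) : ℝ) + 1 = (m + k + 1) + 1 := by push_cast; ring
    have hk : (0 : ℝ) ≤ k := k.cast_nonneg
    rw [h, Real.Gamma_add_one (s := m + k + 1) (by positivity)]
    have h0 : 0 < Real.Gamma (m + k + 1) := Real.Gamma_pos_of_pos (by positivity)
    nlinarith

lemma besselFactor_coeff_mem {m : ℝ} (hm : 0 ≤ m) (k : ℕ) :
    0 ≤ Real.Gamma (m + 1) / (k.factorial * Real.Gamma (m + k + 1)) ∧
      Real.Gamma (m + 1) / (k.factorial * Real.Gamma (m + k + 1)) ≤ 1 / k.factorial := by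
  have hk : (0 : ℝ) ≤ k := k.cast_nonneg
  have h0 : 0 < Real.Gamma (m + k + 1) := Real.Gamma_pos_of_pos (by positivity)
  have h1 : 0 < Real.Gamma (m + 1) := Real.Gamma_pos_of_pos (by positivity)
  have hf : (0 : ℝ) < k.factorial := by exact_mod_cast k.factorial_pos
  refine ⟨by positivity, ?_⟩
  rw [div_le_div_iff₀ (by positivity) hf]
  nlinarith [gamma_le_gamma_add_nat hm k]

lemma norm_besselFactor_term_le {m : ℝ} (hm : 0 ≤ m) (s : ℝ) (k : ℕ) :
    ‖(-s) ^ k * (Real.Gamma (m + 1) / (k.factorial * Real.Gamma (m + k + 1)))‖ ≤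
      |s| ^ k / k.factorial := by
  obtain ⟨h0, h1⟩ := besselFactor_coeff_mem hm k
  rw [norm_mul, norm_pow, Real.norm_eq_abs, abs_neg, Real.norm_eq_abs, abs_of_nonneg h0,
    div_eq_mul_one_div (|s| ^ k)]
  exact mul_le_mul_of_nonneg_left h1 (by positivity)

lemma summable_besselFactor {m : ℝ} (hm : 0 ≤ m) (s : ℝ) :
    Summable fun k : ℕ =>
      (-s) ^ k * (Real.Gamma (m + 1) / (k.factorial * Real.Gamma (m + k + 1))) :=
  Summable.of_norm_bounded (Real.summable_pow_div_factorial |s|) (norm_besselFactor_term_le hm s)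

lemma abs_besselFactor_le {m : ℝ} (hm : 0 ≤ m) (s : ℝ) : |besselFactor m s| ≤ Real.exp |s| := by
  rw [Real.exp_eq_exp_ℝ, NormedSpace.exp_eq_tsum_div]
  exact tsum_of_norm_bounded (Real.summable_pow_div_factorial |s|).hasSum
    (norm_besselFactor_term_le hm s)

@[simp] lemma besselFactor_zero {m : ℝ} (hm : 0 ≤ m) : besselFactor m 0 = 1 := by
  have h1 : Real.Gamma (m + 1) ≠ 0 := (Real.Gamma_pos_of_pos (by positivity)).ne'
  rw [besselFactor, tsum_eq_single 0]
  · simp [h1]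
  · intro k hk
    simp [hk]

lemma hasDerivAt_besselFactor {m : ℝ} (hm : 0 ≤ m) (s : ℝ) :
    HasDerivAt (besselFactor m) (-(besselFactor (m + 1) s / (m + 1))) s := by
  set c : ℕ → ℝ := fun k => Real.Gamma (m + 1) / (k.factorial * Real.Gamma (m + k + 1)) with hc
  have hshift : ∀ k : ℕ, ((k : ℝ) + 1) * c (k + 1) =
      Real.Gamma (m + 1 + 1) / (k.factorial * Real.Gamma (m + 1 + k + 1)) / (m + 1) := by
    intro k
    have hk : (0 : ℝ) ≤ k := k.cast_nonneg
    have e : m + ((k + 1 : ℕ) : ℝ) + 1 = m + 1 + k + 1 := by push_cast; ring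
    have h0 : Real.Gamma (m + 1 + k + 1) ≠ 0 := (Real.Gamma_pos_of_pos (by positivity)).ne'
    have hf : (k.factorial : ℝ) ≠ 0 := by exact_mod_cast k.factorial_ne_zero
    simp only [hc]
    rw [e, Real.Gamma_add_one (s := m + 1) (by positivity), Nat.factorial_succ]
    push_cast
    field_simp
  set g : ℕ → ℝ → ℝ := fun k y => (-y) ^ k * c k
  set g' : ℕ → ℝ → ℝ := fun k y => -((k : ℝ) * (-y) ^ (k - 1) * c k)
  set M : ℝ := |s| + 1
  have hM : (0 : ℝ) ≤ M := by positivity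
  have hbound : ∀ (k : ℕ) (y : ℝ), y ∈ Metric.ball (0 : ℝ) M →
      ‖g' k y‖ ≤ M ^ (k - 1) / (k - 1).factorial := by
    intro k y hy
    have hy' : |y| ≤ M := by simpa using (mem_ball_zero_iff.1 hy).le
    rcases k with _ | k
    · simp [g']
    · have h1 := besselFactor_coeff_mem (by linarith : 0 ≤ m + 1) k
      have h2 := hshift k
      have : g' (k + 1) y = -((-y) ^ k * ((k + 1) * c (k + 1))) := by
        simp [g']; ring
      rw [this, h2, norm_neg, norm_mul, norm_pow, norm_neg, Real.norm_eq_abs, Real.norm_eq_abs,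
        abs_of_nonneg (div_nonneg h1.1 (by positivity)), Nat.add_sub_cancel, div_eq_mul_one_div (M ^ k)]
      have h3 : Real.Gamma (m + 1 + 1) / (k.factorial * Real.Gamma (m + 1 + k + 1)) / (m + 1) ≤
          1 / k.factorial := (div_le_self h1.1 (by linarith)).trans h1.2
      have h4 := div_nonneg h1.1 (by linarith : 0 ≤ m + 1)
      gcongr
  have hsum : Summable fun k : ℕ => M ^ (k - 1) / ((k - 1).factorial : ℝ) := by
    rw [← summable_nat_add_iff 1]
    simpa using Real.summable_pow_div_factorial M
  have key := hasDerivAt_tsum_of_isPreconnected (g := g) (g' := g') hsum Metric.isOpen_ball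
    (convex_ball (0 : ℝ) M).isPreconnected
    (fun k y _ => by
      have := ((hasDerivAt_neg y).pow k).mul_const (c k)
      refine this.congr_deriv ?_
      simp [g'])
    hbound (mem_ball_zero_iff.2 (by simp [M]; positivity)) (summable_besselFactor hm 0)
    (mem_ball_zero_iff.2 (by simp [M]) : s ∈ Metric.ball (0 : ℝ) M)
  refine key.congr_deriv ?_
  have hs' : Summable fun k => g' k s :=
    Summable.of_norm_bounded hsum fun k => hbound k s (mem_ball_zero_iff.2 (by simp [M]))
  rw [hs'.tsum_eq_zero_add, besselFactor, ← tsum_div_const, ← tsum_neg]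
  have h0 : g' 0 s = 0 := by simp [g']
  rw [h0, zero_add]
  refine tsum_congr fun k => ?_
  have : g' (k + 1) s = -((-s) ^ k * ((k + 1) * c (k + 1))) := by
    simp [g']; ring
  rw [this, hshift]
  ring

lemma besselFactor_contiguous {m : ℝ} (hm : 0 ≤ m) (s : ℝ) :
    besselFactor m s =
      besselFactor (m + 1) s - s / ((m + 1) * (m + 2)) * besselFactor (m + 1 + 1) s := by
  have h1 := summable_besselFactor (by linarith : 0 ≤ m + 1) s
  have h2 := summable_besselFactor (by linarith : 0 ≤ m + 1 + 1) s
  have h0 := summable_besselFactor hm s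
  have g1 : Real.Gamma (m + 1) ≠ 0 := (Real.Gamma_pos_of_pos (by positivity)).ne'
  have e1 : Real.Gamma (m + 1 + 1) = (m + 1) * Real.Gamma (m + 1) :=
    Real.Gamma_add_one (by positivity)
  have e2 : Real.Gamma (m + 1 + 1 + 1) = (m + 2) * ((m + 1) * Real.Gamma (m + 1)) := by
    rw [Real.Gamma_add_one (by positivity), e1]; ring
  unfold besselFactor
  rw [h0.tsum_eq_zero_add, h1.tsum_eq_zero_add, ← tsum_mul_left, add_sub_assoc,
    ← ((summable_nat_add_iff 1).2 h1).tsum_sub (h2.mul_left _)]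
  congr 1
  · simp [e1, g1]
    field_simp
  · refine tsum_congr fun k => ?_
    have hk : (0 : ℝ) ≤ k := k.cast_nonneg
    have a1 : m + ((k + 1 : ℕ) : ℝ) + 1 = m + k + 1 + 1 := by push_cast; ring
    have a2 : m + 1 + ((k + 1 : ℕ) : ℝ) + 1 = m + k + 1 + 1 + 1 := by push_cast; ring
    have a3 : m + 1 + 1 + (k : ℝ) + 1 = m + k + 1 + 1 + 1 := by ring
    have hg : Real.Gamma (m + k + 1 + 1) ≠ 0 := (Real.Gamma_pos_of_pos (by positivity)).ne'
    have hf : (k.factorial : ℝ) ≠ 0 := by exact_mod_cast k.factorial_ne_zero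
    rw [a1, a2, a3, Real.Gamma_add_one (s := m + k + 1 + 1) (by positivity), e1, e2,
      Nat.factorial_succ]
    have : m + k + 1 + 1 ≠ 0 := by positivity
    push_cast
    field_simp
    ring

lemma continuous_besselFactor {m : ℝ} (hm : 0 ≤ m) : Continuous (besselFactor m) :=
  continuous_iff_continuousAt.2 fun s => (hasDerivAt_besselFactor hm s).continuousAt

lemma abs_besselFactor_le_two {m s : ℝ} (hm : 0 ≤ m) (hs : 0 ≤ s) (hs' : s ≤ 1 / 4) :
    |besselFactor m s| ≤ 2 := by
  refine (abs_besselFactor_le hm s).trans ?_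
  rw [abs_of_nonneg hs]
  have := Real.exp_bound_div_one_sub_of_interval hs (by linarith)
  refine this.trans ?_
  rw [div_le_iff₀ (by linarith)]
  linarith

lemma half_le_besselFactor {m s : ℝ} (hm : 0 ≤ m) (hs : 0 ≤ s) (hs' : s ≤ 1 / 4) :
    1 / 2 ≤ besselFactor m s := by
  have h := (convex_Icc (0 : ℝ) (1 / 4)).norm_image_sub_le_of_norm_hasDerivWithin_le
    (f := besselFactor m) (f' := fun y => -(besselFactor (m + 1) y / (m + 1))) (C := 2)
    (fun y _ => (hasDerivAt_besselFactor hm y).hasDerivWithinAt)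
    (fun y hy => by
      rw [norm_neg, norm_div, Real.norm_eq_abs, Real.norm_eq_abs, abs_of_nonneg (by linarith : 0 ≤ m + 1)]
      exact (div_le_self (abs_nonneg _) (by linarith)).trans
        (abs_besselFactor_le_two (by linarith) hy.1 hy.2))
    (left_mem_Icc.2 (by norm_num)) (⟨hs, hs'⟩ : s ∈ Icc (0 : ℝ) (1 / 4))
  rw [besselFactor_zero hm, Real.norm_eq_abs, Real.norm_eq_abs, sub_zero, abs_of_nonneg hs] at h
  have := (abs_le.1 h).1
  linarith

lemma besselJ_eq {ν x : ℝ} (hν : 0 ≤ ν) (hx : 0 < x) :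
    besselJ ν x = (x / 2) ^ ν / Real.Gamma (ν + 1) * besselFactor ν (x ^ 2 / 4) := by
  rw [besselJ, besselFactor, ← tsum_mul_left]
  refine tsum_congr fun k => ?_
  have g1 : Real.Gamma (ν + 1) ≠ 0 := (Real.Gamma_pos_of_pos (by positivity)).ne'
  have e : (x / 2) ^ (2 * (k : ℝ) + ν) = (x ^ 2 / 4) ^ k * (x / 2) ^ ν := by
    rw [Real.rpow_add (by positivity), Real.rpow_mul (by positivity), Real.rpow_natCast]
    congr 2
    norm_num
    ring
  rw [e, neg_pow (x ^ 2 / 4), show (k : ℝ) + ν + 1 = ν + k + 1 by ring]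
  field_simp

/-- The solution `r ^ m * (1 + O(r²))` of the radial equation with parameter `μ = 4κ`. -/
def radialSol (κ m r : ℝ) : ℝ := r ^ m * besselFactor m (κ * r ^ 2)

/-- The factor of `r ^ m` in the Euler derivative `r * (radialSol κ m)'`, at `s = κ r²`. -/
def eulerFactor (m s : ℝ) : ℝ :=
  m * besselFactor m s - 2 * s * (besselFactor (m + 1) s / (m + 1))

lemma continuous_eulerFactor {m : ℝ} (hm : 0 ≤ m) : Continuous (eulerFactor m) := by
  have h1 := continuous_besselFactor hm
  have h2 := continuous_besselFactor (by linarith : 0 ≤ m + 1)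
  unfold eulerFactor
  fun_prop

lemma abs_eulerFactor_le {m s : ℝ} (hm : 0 ≤ m) (hs : 0 ≤ s) (hs' : s ≤ 1 / 4) :
    |eulerFactor m s| ≤ 2 * m + 1 := by
  have h1 := abs_besselFactor_le_two hm hs hs'
  have h2 := abs_besselFactor_le_two (by linarith : 0 ≤ m + 1) hs hs'
  have h3 : |besselFactor (m + 1) s / (m + 1)| ≤ 2 := by
    rw [abs_div, abs_of_nonneg (by linarith : 0 ≤ m + 1)]
    exact (div_le_self (abs_nonneg _) (by linarith)).trans h2
  rw [abs_le] at *
  unfold eulerFactor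
  constructor <;> nlinarith

lemma hasDerivAt_radialSol {κ m r : ℝ} (hm : 0 ≤ m) (hr : 0 < r) :
    HasDerivAt (radialSol κ m) (r ^ m * eulerFactor m (κ * r ^ 2) / r) r := by
  have h1 : HasDerivAt (fun y : ℝ => κ * y ^ 2) (κ * (2 * r)) r := by
    simpa using (hasDerivAt_pow 2 r).const_mul κ
  have h2 := (hasDerivAt_besselFactor hm (κ * r ^ 2)).comp r h1
  have h3 := (Real.hasDerivAt_rpow_const (x := r) (p := m) (Or.inl hr.ne')).mul h2
  refine h3.congr_deriv ?_
  rw [Real.rpow_sub_one hr.ne', eulerFactor]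
  simp only [Function.comp]
  have : m + 1 ≠ 0 := by positivity
  field_simp
  ring

lemma hasDerivAt_euler_radialSol {κ m r : ℝ} (hm : 0 ≤ m) (hr : 0 < r) :
    HasDerivAt (fun r => r ^ m * eulerFactor m (κ * r ^ 2))
      ((m ^ 2 / r - 4 * κ * r) * radialSol κ m r) r := by
  have h1 : HasDerivAt (fun y : ℝ => κ * y ^ 2) (κ * (2 * r)) r := by
    simpa using (hasDerivAt_pow 2 r).const_mul κ
  have h2 := (hasDerivAt_besselFactor hm (κ * r ^ 2)).comp r h1
  have h2' := (hasDerivAt_besselFactor (by linarith : 0 ≤ m + 1) (κ * r ^ 2)).comp r h1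
  have h3 := (Real.hasDerivAt_rpow_const (x := r) (p := m) (Or.inl hr.ne')).mul
    ((h2.const_mul m).sub ((h1.const_mul 2).mul (h2'.div_const (m + 1))))
  refine h3.congr_deriv ?_
  have hc := besselFactor_contiguous hm (κ * r ^ 2)
  have : m + 1 ≠ 0 := by positivity
  have h22 : m + 2 ≠ 0 := by positivity
  have h4 : besselFactor (m + 1 + 1) (κ * r ^ 2) * (κ * r ^ 2) =
      (besselFactor (m + 1) (κ * r ^ 2) - besselFactor m (κ * r ^ 2)) * ((m + 1) * (m + 2)) := by
    rw [hc]; field_simp; ring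
  rw [Real.rpow_sub_one hr.ne', radialSol]
  simp only [Function.comp, Pi.sub_apply, Pi.mul_apply]
  rw [show m + 1 + 1 = m + 2 by ring] at *
  generalize besselFactor (m + 2) (κ * r ^ 2) = C at *
  generalize besselFactor (m + 1) (κ * r ^ 2) = B at *
  generalize besselFactor m (κ * r ^ 2) = A at *
  generalize r ^ m = P at *
  field_simp
  linear_combination (4 * κ * r ^ 2 * P) * h4

lemma const_of_hasDerivAt_zero {f : ℝ → ℝ} {s : Set ℝ} (hs : Convex ℝ s)
    (hf : ∀ x ∈ s, HasDerivAt f 0 x) {x y : ℝ} (hx : x ∈ s) (hy : y ∈ s) : f x = f y := by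
  have := hs.norm_image_sub_le_of_norm_hasDerivWithin_le (f := f) (f' := fun _ => 0) (C := 0)
    (fun z hz => (hf z hz).hasDerivWithinAt) (fun z _ => by simp) hx hy
  rw [zero_mul, norm_le_zero_iff, sub_eq_zero] at this
  exact this.symm

lemma radialSol_bounds {κ m r R : ℝ} (hκ : 0 < κ) (hm : 0 ≤ m) (hR : κ * R ^ 2 ≤ 1 / 4)
    (hr : 0 < r) (hrR : r ≤ R) : r ^ m / 2 ≤ radialSol κ m r ∧ radialSol κ m r ≤ 2 * r ^ m := by
  have h0 : 0 ≤ κ * r ^ 2 := by positivity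
  have h1 : κ * r ^ 2 ≤ 1 / 4 := le_trans (by gcongr) hR
  have h2 := half_le_besselFactor hm h0 h1
  have h3 := (abs_le.1 (abs_besselFactor_le_two hm h0 h1)).2
  have h4 : 0 < r ^ m := Real.rpow_pos_of_pos hr m
  unfold radialSol
  constructor <;> nlinarith

/-- A solution of the radial equation on `(0, ∞)` with a limit at `0` is a multiple of the
regular solution. -/
lemma exists_eq_mul_radialSol {κ m R a₀ : ℝ} {a p : ℝ → ℝ} (hκ : 0 < κ) (hm : 0 ≤ m)
    (hR0 : 0 < R) (hR : κ * R ^ 2 ≤ 1 / 4)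
    (ha : ∀ r, 0 < r → HasDerivAt a (p r / r) r)
    (hp : ∀ r, 0 < r → HasDerivAt p ((m ^ 2 / r - 4 * κ * r) * a r) r)
    (hlim : Tendsto a (nhdsWithin 0 (Ioi 0)) (nhds a₀)) (h0 : m = 0 ∨ a₀ = 0) :
    ∃ C, ∀ r ∈ Ioc 0 R, a r = C * radialSol κ m r := by
  set q : ℝ → ℝ := fun r => r ^ m * eulerFactor m (κ * r ^ 2)
  set w : ℝ → ℝ := fun r => a r * q r - p r * radialSol κ m r
  have hw' : ∀ r ∈ Ioi (0 : ℝ), HasDerivAt w 0 r := by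
    intro r hr
    have hr0 : r ≠ 0 := ne_of_gt hr
    refine (((ha r hr).mul (hasDerivAt_euler_radialSol hm hr)).sub
      ((hp r hr).mul (hasDerivAt_radialSol hm hr))).congr_deriv ?_
    field_simp
    ring
  have hw : ∀ r, 0 < r → w r = w 1 := fun r hr =>
    const_of_hasDerivAt_zero (convex_Ioi 0) hw' hr (mem_Ioi.2 one_pos)
  set d : ℝ → ℝ := fun r => a r / radialSol κ m r
  have hjpos : ∀ r, 0 < r → r ≤ R → 0 < radialSol κ m r := fun r hr hrR =>
    lt_of_lt_of_le (by have := Real.rpow_pos_of_pos hr m; positivity)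
      (radialSol_bounds hκ hm hR hr hrR).1
  have hd' : ∀ r, 0 < r → r ≤ R → HasDerivAt d (-(w 1 / (r * radialSol κ m r ^ 2))) r := by
    intro r hr hrR
    have hj := (hjpos r hr hrR).ne'
    refine ((ha r hr).div (hasDerivAt_radialSol hm hr) hj).congr_deriv ?_
    rw [← hw r hr]
    simp only [w, q]
    field_simp
    ring
  have hw0 : w 1 = 0 := by
    by_contra hne
    have hcm := continuous_besselFactor hm
    have hφ : Tendsto (fun r : ℝ => besselFactor m (κ * r ^ 2)) (nhdsWithin 0 (Ioi 0)) (nhds 1) := by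
      have : Continuous fun r : ℝ => besselFactor m (κ * r ^ 2) := by fun_prop
      have h := (this.tendsto 0).mono_left (nhdsWithin_le_nhds (s := Ioi 0))
      simpa [besselFactor_zero hm] using h
    have h2r : Tendsto (fun r : ℝ => 2 * r) (nhdsWithin 0 (Ioi 0)) (nhdsWithin 0 (Ioi 0)) := by
      refine tendsto_nhdsWithin_iff.2 ⟨?_, ?_⟩
      · have : Continuous fun r : ℝ => 2 * r := by fun_prop
        have h := (this.tendsto 0).mono_left (nhdsWithin_le_nhds (s := Ioi 0))
        simpa using h
      · filter_upwards [self_mem_nhdsWithin] with r hr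
        have : (0 : ℝ) < r := hr
        simpa using this
    have hl1 := ((hlim.comp h2r).div (hφ.comp h2r) one_ne_zero).div_const ((2 : ℝ) ^ m)
    have hl := hl1.sub (hlim.div hφ one_ne_zero)
    have hz : a₀ / 1 / 2 ^ m - a₀ / 1 = 0 := by
      rcases h0 with h | h <;> simp [h]
    rw [hz] at hl
    have hQ : (0 : ℝ) < 2 ^ m := Real.rpow_pos_of_pos two_pos m
    have hε : 0 < |w 1| / (8 * (2 ^ m) ^ 2) := by
      have := abs_pos.2 hne
      positivity
    have hev := (Metric.tendsto_nhds.1 hl _ hε).and (Ioo_mem_nhdsGT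
      (show (0 : ℝ) < min R 1 / 2 by positivity))
    obtain ⟨r, hr1, hr2, hr3⟩ := hev.exists
    have hrR : 2 * r ≤ R := by linarith [min_le_left R 1]
    have hr_one : r ≤ 1 := by linarith [min_le_right R 1]
    obtain ⟨x, hx, hxe⟩ := exists_hasDerivAt_eq_slope d
      (fun r => -(w 1 / (r * radialSol κ m r ^ 2))) (by linarith : r < 2 * r)
      (fun y hy => (hd' y (hr2.trans_le hy.1) (hy.2.trans hrR)).continuousAt.continuousWithinAt)
      (fun y hy => hd' y (hr2.trans hy.1) (hy.2.le.trans hrR))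
    have hx0 : 0 < x := hr2.trans hx.1
    have hxR : x ≤ R := hx.2.le.trans hrR
    have hP : 0 < r ^ m := Real.rpow_pos_of_pos hr2 m
    have hP1 : r ^ m ≤ 1 := Real.rpow_le_one hr2.le hr_one hm
    have hjx := hjpos x hx0 hxR
    have hjx2 : radialSol κ m x ≤ 2 * (2 ^ m * r ^ m) := by
      refine (radialSol_bounds hκ hm hR hx0 hxR).2.trans ?_
      rw [← Real.mul_rpow two_pos.le hr2.le]
      have := Real.rpow_le_rpow hx0.le hx.2.le hm
      linarith
    have e1 : d (2 * r) - d r = -(w 1 / (x * radialSol κ m x ^ 2)) * r := by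
      rw [hxe]; field_simp; ring
    have hE : r ^ m * (d (2 * r) - d r) =
        a (2 * r) / besselFactor m (κ * (2 * r) ^ 2) / 2 ^ m - a r / besselFactor m (κ * r ^ 2) := by
      have hj1 := (hjpos r hr2 (by linarith)).ne'
      have hj2 := (hjpos (2 * r) (by linarith) hrR).ne'
      simp only [d, radialSol] at hj1 hj2 ⊢
      rw [Real.mul_rpow two_pos.le hr2.le] at hj2 ⊢
      have f1 := right_ne_zero_of_mul hj1
      have f2 := right_ne_zero_of_mul hj2
      field_simp
    have hr1' : |r ^ m * (d (2 * r) - d r)| < |w 1| / (8 * (2 ^ m) ^ 2) := by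
      rw [hE]
      simpa [Function.comp, Real.dist_eq] using hr1
    rw [e1, abs_mul, abs_mul, abs_neg, abs_div, abs_of_pos hP, abs_of_pos hr2,
      abs_of_pos (by positivity : 0 < x * radialSol κ m x ^ 2)] at hr1'
    refine absurd hr1' (not_lt.2 ?_)
    have hden : x * radialSol κ m x ^ 2 ≤ r * (r ^ m * (8 * (2 ^ m) ^ 2)) := by
      calc x * radialSol κ m x ^ 2 ≤ (2 * r) * (2 * (2 ^ m * r ^ m)) ^ 2 := by
            gcongr
            exact hx.2.le
        _ = (r * (r ^ m * (8 * (2 ^ m) ^ 2))) * r ^ m := by ring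
        _ ≤ (r * (r ^ m * (8 * (2 ^ m) ^ 2))) * 1 := by gcongr
        _ = _ := by ring
    have hwpos := abs_pos.2 hne
    calc |w 1| / (8 * (2 ^ m) ^ 2)
        = r ^ m * (|w 1| / (r * (r ^ m * (8 * (2 ^ m) ^ 2))) * r) := by field_simp
      _ ≤ _ := by gcongr
  refine ⟨d R, fun r hr => ?_⟩
  have hc : d r = d R := const_of_hasDerivAt_zero (convex_Ioc 0 R)
    (fun y hy => by simpa [hw0] using hd' y hy.1 hy.2) hr ⟨hR0, le_rfl⟩
  rw [← hc, div_mul_cancel₀ _ (hjpos r hr.1 hr.2).ne']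

/-- A solution of the radial equation vanishing near `0` vanishes identically. -/
lemma radial_eq_zero {κ m R : ℝ} {a p : ℝ → ℝ} (hR0 : 0 < R)
    (ha : ∀ r, 0 < r → HasDerivAt a (p r / r) r)
    (hp : ∀ r, 0 < r → HasDerivAt p ((m ^ 2 / r - 4 * κ * r) * a r) r)
    (hz : ∀ r ∈ Ioc 0 R, a r = 0) {t : ℝ} (ht : 0 < t) : a t = 0 := by
  rcases le_or_gt t R with h | h
  · exact hz t ⟨ht, h⟩
  set s := R / 2
  have hs : 0 < s := by positivity
  have hsR : s < R := by simp only [s]; linarith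
  have has : a s = 0 := hz s ⟨hs, hsR.le⟩
  have hps : p s = 0 := by
    have h1 : HasDerivAt a 0 s := by
      refine (hasDerivAt_const s (0 : ℝ)).congr_of_eventuallyEq ?_
      filter_upwards [Ioo_mem_nhds hs hsR] with y hy using hz y ⟨hy.1, hy.2.le⟩
    have := (ha s hs).unique h1
    simpa [hs.ne'] using this
  set D := 1 / s + m ^ 2 / s + 4 * |κ| * t
  have hD : 0 ≤ D := by positivity
  have hder : ∀ r, 0 < r → HasDerivAt (fun r => (a r ^ 2 + p r ^ 2) * Real.exp (-(D * r)))
      ((2 * a r * p r * (1 / r + (m ^ 2 / r - 4 * κ * r)) - D * (a r ^ 2 + p r ^ 2)) *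
        Real.exp (-(D * r))) r := by
    intro r hr
    have h1 : HasDerivAt (fun r => Real.exp (-(D * r))) (Real.exp (-(D * r)) * (-(D * 1))) r :=
      (((hasDerivAt_id r).const_mul D).neg).exp
    refine ((((ha r hr).pow 2).add ((hp r hr).pow 2)).mul h1).congr_deriv ?_
    simp
    ring
  have hanti : AntitoneOn (fun r => (a r ^ 2 + p r ^ 2) * Real.exp (-(D * r))) (Icc s t) := by
    refine antitoneOn_of_hasDerivWithinAt_nonpos (convex_Icc s t)
      (fun r hr => (hder r (hs.trans_le hr.1)).continuousAt.continuousWithinAt)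
      (fun r hr => (hder r ?_).hasDerivWithinAt) (fun r hr => ?_)
    · rw [interior_Icc] at hr
      exact hs.trans hr.1
    · rw [interior_Icc] at hr
      have hr0 : 0 < r := hs.trans hr.1
      refine mul_nonpos_of_nonpos_of_nonneg ?_ (Real.exp_pos _).le
      have hb : |1 / r + (m ^ 2 / r - 4 * κ * r)| ≤ D := by
        have h1 : 1 / r ≤ 1 / s := by gcongr; exact hr.1.le
        have h2 : m ^ 2 / r ≤ m ^ 2 / s := by gcongr; exact hr.1.le
        have h3 : |4 * κ * r| ≤ 4 * |κ| * t := by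
          rw [abs_mul, abs_mul, abs_of_pos hr0]
          norm_num
          gcongr
          exact hr.2.le
        have h4 : 0 ≤ 1 / r := by positivity
        have h5 : 0 ≤ m ^ 2 / r := by positivity
        rw [abs_le] at *
        constructor <;> simp only [D] <;> linarith
      have h6 : |2 * a r * p r| ≤ a r ^ 2 + p r ^ 2 := by
        rw [abs_le]
        constructor <;> nlinarith [sq_nonneg (a r + p r), sq_nonneg (a r - p r)]
      have h7 := abs_mul (2 * a r * p r) (1 / r + (m ^ 2 / r - 4 * κ * r))
      have h8 := le_abs_self (2 * a r * p r * (1 / r + (m ^ 2 / r - 4 * κ * r)))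
      have h9 : |2 * a r * p r| * |1 / r + (m ^ 2 / r - 4 * κ * r)| ≤
          (a r ^ 2 + p r ^ 2) * D := by gcongr
      linarith
  have hst : s ≤ t := by linarith
  have := hanti (left_mem_Icc.2 hst) (right_mem_Icc.2 hst) hst
  simp only [has, hps] at this
  have he := Real.exp_pos (-(D * t))
  have h2 : a t ^ 2 + p t ^ 2 ≤ 0 := by
    by_contra hc
    push Not at hc
    have := mul_pos hc he
    norm_num at *
    linarith
  nlinarith [sq_nonneg (p t), sq_nonneg (a t)]

/-- The parameter domain `(0, ∞) × [0, β]` of polar coordinates on the punctured sector. -/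
def polarDomain (β : ℝ) : Set (ℝ × ℝ) := Ioi 0 ×ˢ Icc 0 β

/-- The polar coordinate map. -/
def polarMap (r θ : ℝ) : ℂ := (r : ℂ) * Complex.exp (Complex.I * (θ : ℂ))

lemma uniqueDiffOn_polarDomain {β : ℝ} (hβ : 0 < β) : UniqueDiffOn ℝ (polarDomain β) :=
  (isOpen_Ioi.uniqueDiffOn).prod (uniqueDiffOn_Icc hβ)

lemma exists_partials {β : ℝ} (hβ : 0 < β) {f : ℝ × ℝ → ℝ}
    (hf : ContDiffOn ℝ (⊤ : ℕ∞) f (polarDomain β)) :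
    ∃ f₁ f₂ : ℝ × ℝ → ℝ, ContDiffOn ℝ (⊤ : ℕ∞) f₁ (polarDomain β) ∧
      ContDiffOn ℝ (⊤ : ℕ∞) f₂ (polarDomain β) ∧
      ∀ r, 0 < r → ∀ θ ∈ Icc 0 β, HasDerivAt (fun r => f (r, θ)) (f₁ (r, θ)) r ∧
        HasDerivWithinAt (fun θ => f (r, θ)) (f₂ (r, θ)) (Icc 0 β) θ := by
  have hd : ContDiffOn ℝ (⊤ : ℕ∞) (fderivWithin ℝ f (polarDomain β)) (polarDomain β) :=
    hf.fderivWithin (uniqueDiffOn_polarDomain hβ) (by simp)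
  refine ⟨fun p => fderivWithin ℝ f (polarDomain β) p (1, 0),
    fun p => fderivWithin ℝ f (polarDomain β) p (0, 1),
    hd.clm_apply contDiffOn_const, hd.clm_apply contDiffOn_const, fun r hr θ hθ => ⟨?_, ?_⟩⟩
  · have h := (hf.differentiableOn (by simp) (r, θ) ⟨hr, hθ⟩).hasFDerivWithinAt
    refine h.comp_hasDerivAt (f := fun r => (r, θ)) r ((hasDerivAt_id r).prodMk (hasDerivAt_const r θ)) ?_
    filter_upwards [Ioi_mem_nhds hr] with y hy using ⟨hy, hθ⟩
  · have h := (hf.differentiableOn (by simp) (r, θ) ⟨hr, hθ⟩).hasFDerivWithinAt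
    exact h.comp_hasDerivWithinAt (f := fun θ => (r, θ)) θ
      ((hasDerivWithinAt_const θ _ r).prodMk (hasDerivWithinAt_id θ _)) fun y hy => ⟨hr, hy⟩

lemma continuousOn_slice {β : ℝ} {f : ℝ × ℝ → ℝ} (hf : ContinuousOn f (polarDomain β)) {r : ℝ}
    (hr : 0 < r) : ContinuousOn (fun θ => f (r, θ)) (Icc 0 β) :=
  hf.comp (by fun_prop) fun _ hθ => ⟨hr, hθ⟩

lemma hasDerivAt_integral_mul {β : ℝ} (hβ : 0 < β) {f f₁ : ℝ × ℝ → ℝ}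
    (hf : ContinuousOn f (polarDomain β)) (hf₁ : ContinuousOn f₁ (polarDomain β))
    (hd : ∀ r, 0 < r → ∀ θ ∈ Icc 0 β, HasDerivAt (fun r => f (r, θ)) (f₁ (r, θ)) r)
    {g : ℝ → ℝ} (hg : Continuous g) {r : ℝ} (hr : 0 < r) :
    HasDerivAt (fun r => ∫ θ in (0)..β, f (r, θ) * g θ) (∫ θ in (0)..β, f₁ (r, θ) * g θ) r := by
  have hcont : ∀ {h : ℝ × ℝ → ℝ}, ContinuousOn h (polarDomain β) → ∀ r, 0 < r →
      ContinuousOn (fun θ => h (r, θ) * g θ) (uIcc 0 β) := fun hh r hr => by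
    rw [uIcc_of_le hβ.le]
    exact (continuousOn_slice hh hr).mul hg.continuousOn
  have hK : IsCompact (Icc (r / 2) (2 * r) ×ˢ Icc 0 β) := isCompact_Icc.prod isCompact_Icc
  obtain ⟨C, hC⟩ := hK.exists_bound_of_continuousOn (f := fun p : ℝ × ℝ => f₁ p * g p.2)
    ((hf₁.mono fun p hp => ⟨(by positivity : (0 : ℝ) < r / 2).trans_le hp.1.1, hp.2⟩).mul
      (by fun_prop))
  refine (intervalIntegral.hasDerivAt_integral_of_dominated_loc_of_deriv_le
    (F := fun r θ => f (r, θ) * g θ) (F' := fun r θ => f₁ (r, θ) * g θ)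
    (s := Ioo (r / 2) (2 * r)) (bound := fun _ => C) (Ioo_mem_nhds (by linarith) (by linarith))
    ?_ (hcont hf r hr).intervalIntegrable ?_ ?_ intervalIntegrable_const ?_).2
  · filter_upwards [Ioi_mem_nhds hr] with x hx
    exact (intervalIntegrable_iff.1 (hcont hf x hx).intervalIntegrable).aestronglyMeasurable
  · exact (intervalIntegrable_iff.1 (hcont hf₁ r hr).intervalIntegrable).aestronglyMeasurable
  · refine Filter.Eventually.of_forall fun θ hθ x hx => ?_
    rw [uIoc_of_le hβ.le] at hθ
    exact hC (x, θ) ⟨⟨hx.1.le, hx.2.le⟩, hθ.1.le, hθ.2⟩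
  · refine Filter.Eventually.of_forall fun θ hθ x hx => ?_
    rw [uIoc_of_le hβ.le] at hθ
    exact (hd x ((by positivity : (0 : ℝ) < r / 2).trans hx.1) θ ⟨hθ.1.le, hθ.2⟩).mul_const _

lemma hasDerivAt_polarMap_left (r θ : ℝ) :
    HasDerivAt (fun r : ℝ => polarMap r θ) (Complex.exp (Complex.I * θ)) r := by
  unfold polarMap
  simpa using (Complex.ofRealCLM.hasDerivAt (x := r)).mul_const (Complex.exp (Complex.I * θ))

lemma hasDerivAt_polarMap_right (r θ : ℝ) :
    HasDerivAt (fun θ : ℝ => polarMap r θ) (polarMap r θ * Complex.I) θ := by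
  unfold polarMap
  have h1 : HasDerivAt (fun θ : ℝ => Complex.I * (θ : ℂ)) (Complex.I * 1) θ :=
    (Complex.ofRealCLM.hasDerivAt (x := θ)).const_mul Complex.I
  refine (h1.cexp.const_mul (r : ℂ)).congr_deriv ?_
  ring

lemma norm_polarMap {r : ℝ} (hr : 0 ≤ r) (θ : ℝ) : ‖polarMap r θ‖ = r := by
  rw [polarMap, norm_mul, mul_comm Complex.I, Complex.norm_exp_ofReal_mul_I, mul_one,
    Complex.norm_real, Real.norm_of_nonneg hr]

lemma polarMap_ne_zero {r : ℝ} (hr : 0 < r) (θ : ℝ) : polarMap r θ ≠ 0 := by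
  rw [← norm_pos_iff, norm_polarMap hr.le]; exact hr

lemma polarMap_mem {β r θ : ℝ} (hr : 0 ≤ r) (hθ : θ ∈ Icc 0 β) :
    polarMap r θ ∈ closedSector β := ⟨r, hr, θ, hθ.1, hθ.2, rfl⟩

lemma polarMap_mem_diff {β r θ : ℝ} (hr : 0 < r) (hθ : θ ∈ Icc 0 β) :
    polarMap r θ ∈ closedSector β \ {0} := ⟨polarMap_mem hr.le hθ, polarMap_ne_zero hr θ⟩

lemma closedSector_diff_mem_nhds {β r θ : ℝ} (hβ : β < Real.pi) (hr : 0 < r)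
    (hθ : θ ∈ Ioo 0 β) : closedSector β \ {0} ∈ nhds (polarMap r θ) := by
  have harg : Complex.arg (polarMap r θ) = θ := by
    rw [polarMap, mul_comm Complex.I, Complex.exp_mul_I]
    exact Complex.arg_mul_cos_add_sin_mul_I hr
      ⟨by linarith [hθ.1, Real.pi_pos], by linarith [hθ.2]⟩
  have hs : polarMap r θ ∈ Complex.slitPlane := by
    rw [Complex.mem_slitPlane_iff_arg, harg]
    exact ⟨(hθ.2.trans hβ).ne, polarMap_ne_zero hr θ⟩
  have hc := Complex.continuousAt_arg hs
  have hc' := hc.preimage_mem_nhds (t := Ioo 0 β) (by rw [harg]; exact Ioo_mem_nhds hθ.1 hθ.2)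
  filter_upwards [hc', compl_singleton_mem_nhds (polarMap_ne_zero hr θ)] with z hz hz0
  refine ⟨⟨‖z‖, norm_nonneg z, Complex.arg z, hz.1.le, hz.2.le, ?_⟩, hz0⟩
  rw [mul_comm Complex.I, Complex.norm_mul_exp_arg_mul_I]

/-- The function `u` in polar coordinates, with its derivatives up to second order. -/
structure PolarData (β μ : ℝ) (u : ℂ → ℝ) (U₁ U₁₁ U₂ U₂₂ : ℝ × ℝ → ℝ) : Prop where
  cont : ContinuousOn (fun p : ℝ × ℝ => u (polarMap p.1 p.2)) (polarDomain β)
  cont₁ : ContinuousOn U₁ (polarDomain β)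
  cont₁₁ : ContinuousOn U₁₁ (polarDomain β)
  cont₂ : ContinuousOn U₂ (polarDomain β)
  cont₂₂ : ContinuousOn U₂₂ (polarDomain β)
  deriv₁ : ∀ r, 0 < r → ∀ θ ∈ Icc 0 β, HasDerivAt (fun r => u (polarMap r θ)) (U₁ (r, θ)) r
  deriv₁₁ : ∀ r, 0 < r → ∀ θ ∈ Icc 0 β, HasDerivAt (fun r => U₁ (r, θ)) (U₁₁ (r, θ)) r
  deriv₂ : ∀ r, 0 < r → ∀ θ ∈ Icc 0 β,
    HasDerivWithinAt (fun θ => u (polarMap r θ)) (U₂ (r, θ)) (Icc 0 β) θ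
  deriv₂₂ : ∀ r, 0 < r → ∀ θ ∈ Icc 0 β,
    HasDerivWithinAt (fun θ => U₂ (r, θ)) (U₂₂ (r, θ)) (Icc 0 β) θ
  left : ∀ r, 0 < r → U₂ (r, 0) = 0
  right : ∀ r, 0 < r → U₂ (r, β) = 0
  polar : ∀ r, 0 < r → ∀ θ ∈ Ioo 0 β,
    r ^ 2 * U₁₁ (r, θ) + r * U₁ (r, θ) + U₂₂ (r, θ) = -μ * r ^ 2 * u (polarMap r θ)

section

variable {β μ : ℝ} {u : ℂ → ℝ}

lemma hasFDerivWithinAt_sector (hu : IsSectorNeumannEigenfun β u μ) {r θ : ℝ} (hr : 0 < r)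
    (hθ : θ ∈ Icc 0 β) : HasFDerivWithinAt u (fderivWithin ℝ u (closedSector β) (polarMap r θ))
      (closedSector β) (polarMap r θ) := by
  refine DifferentiableWithinAt.hasFDerivWithinAt ?_
  have h := hu.smooth.differentiableOn (by simp) _ (polarMap_mem_diff hr hθ)
  refine h.mono_of_mem_nhdsWithin ?_
  exact inter_mem_nhdsWithin _ (compl_singleton_mem_nhds (polarMap_ne_zero hr θ))

lemma hasDerivAt_sector_left (hu : IsSectorNeumannEigenfun β u μ) {r θ : ℝ} (hr : 0 < r)
    (hθ : θ ∈ Icc 0 β) : HasDerivAt (fun r => u (polarMap r θ))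
      (fderivWithin ℝ u (closedSector β) (polarMap r θ) (Complex.exp (Complex.I * θ))) r := by
  refine (hasFDerivWithinAt_sector hu hr hθ).comp_hasDerivAt (f := fun r => polarMap r θ) r
    (hasDerivAt_polarMap_left r θ) ?_
  filter_upwards [Ioi_mem_nhds hr] with y hy using polarMap_mem (le_of_lt hy) hθ

lemma hasDerivWithinAt_sector_right (hu : IsSectorNeumannEigenfun β u μ) {r θ : ℝ} (hr : 0 < r)
    (hθ : θ ∈ Icc 0 β) : HasDerivWithinAt (fun θ => u (polarMap r θ))
      (fderivWithin ℝ u (closedSector β) (polarMap r θ) (polarMap r θ * Complex.I))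
        (Icc 0 β) θ :=
  (hasFDerivWithinAt_sector hu hr hθ).comp_hasDerivWithinAt (f := fun θ => polarMap r θ) θ
    (hasDerivAt_polarMap_right r θ).hasDerivWithinAt fun _ hy => polarMap_mem hr.le hy

lemma laplacian_eq_rotated (D : ℂ →L[ℝ] ℂ →L[ℝ] ℝ) (r θ : ℝ) :
    r ^ 2 * D (Complex.exp (Complex.I * θ)) (Complex.exp (Complex.I * θ)) +
      D (polarMap r θ * Complex.I) (polarMap r θ * Complex.I) =
        r ^ 2 * (D 1 1 + D Complex.I Complex.I) := by
  have h1 : Complex.exp (Complex.I * θ) = Real.cos θ • (1 : ℂ) + Real.sin θ • Complex.I := by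
    rw [mul_comm, Complex.exp_mul_I]
    simp
  have h2 : polarMap r θ * Complex.I =
      r • (Real.cos θ • Complex.I + (-Real.sin θ) • (1 : ℂ)) := by
    rw [polarMap, h1]
    apply Complex.ext <;> simp
  have h3 := Real.sin_sq_add_cos_sq θ
  rw [h1, h2]
  simp only [map_add, map_smul, add_apply, smul_apply,
    smul_eq_mul]
  linear_combination (r ^ 2 * (D 1 1 + D Complex.I Complex.I)) * h3

lemma exists_polarData (hβ : 0 < β) (hβπ : β < Real.pi) (hu : IsSectorNeumannEigenfun β u μ) :
    ∃ U₁ U₁₁ U₂ U₂₂, PolarData β μ u U₁ U₁₁ U₂ U₂₂ := by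
  have hP : ContDiff ℝ (⊤ : ℕ∞) fun p : ℝ × ℝ => polarMap p.1 p.2 := by
    unfold polarMap
    have h1 : ContDiff ℝ (⊤ : ℕ∞) fun p : ℝ × ℝ => (p.1 : ℂ) :=
      Complex.ofRealCLM.contDiff.comp contDiff_fst
    have h2 : ContDiff ℝ (⊤ : ℕ∞) fun p : ℝ × ℝ => (p.2 : ℂ) :=
      Complex.ofRealCLM.contDiff.comp contDiff_snd
    fun_prop
  have hU : ContDiffOn ℝ (⊤ : ℕ∞) (fun p : ℝ × ℝ => u (polarMap p.1 p.2)) (polarDomain β) :=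
    hu.smooth.comp hP.contDiffOn fun p hp => polarMap_mem_diff hp.1 hp.2
  obtain ⟨U₁, U₂, c1, c2, hd⟩ := exists_partials hβ hU
  obtain ⟨U₁₁, _, c11, _, hd1⟩ := exists_partials hβ c1
  obtain ⟨_, U₂₂, _, c22, hd2⟩ := exists_partials hβ c2
  have e1 : ∀ r, 0 < r → ∀ θ ∈ Icc 0 β, U₁ (r, θ) =
      fderivWithin ℝ u (closedSector β) (polarMap r θ) (Complex.exp (Complex.I * θ)) :=
    fun r hr θ hθ => (hd r hr θ hθ).1.unique (hasDerivAt_sector_left hu hr hθ)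
  have e2 : ∀ r, 0 < r → ∀ θ ∈ Icc 0 β, U₂ (r, θ) =
      fderivWithin ℝ u (closedSector β) (polarMap r θ) (polarMap r θ * Complex.I) :=
    fun r hr θ hθ => (uniqueDiffOn_Icc hβ θ hθ).eq_deriv _ (hd r hr θ hθ).2
      (hasDerivWithinAt_sector_right hu hr hθ)
  refine ⟨U₁, U₁₁, U₂, U₂₂, ⟨hU.continuousOn, c1.continuousOn, c11.continuousOn, c2.continuousOn,
    c22.continuousOn, fun r hr θ hθ => (hd r hr θ hθ).1, fun r hr θ hθ => (hd1 r hr θ hθ).1,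
    fun r hr θ hθ => (hd r hr θ hθ).2, fun r hr θ hθ => (hd2 r hr θ hθ).2, ?_, ?_, ?_⟩⟩
  · intro r hr
    rw [e2 r hr 0 ⟨le_rfl, hβ.le⟩]
    have h : polarMap r 0 = (r : ℂ) := by simp [polarMap]
    rw [h, show (r : ℂ) * Complex.I = r • Complex.I by simp, map_smul, hu.neumann_bottom r hr,
      smul_zero]
  · intro r hr
    rw [e2 r hr β ⟨hβ.le, le_rfl⟩]
    have h : polarMap r β * Complex.I = r • (Complex.I * Complex.exp (Complex.I * β)) := by
      rw [polarMap, Complex.real_smul]; ring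
    rw [h, map_smul, polarMap, hu.neumann_top r hr, smul_zero]
  · intro r hr θ hθ
    have hθ' : θ ∈ Icc 0 β := ⟨hθ.1.le, hθ.2.le⟩
    have hfd : ∀ r, 0 < r → ∀ θ ∈ Ioo 0 β,
        fderivWithin ℝ u (closedSector β) (polarMap r θ) = fderiv ℝ u (polarMap r θ) :=
      fun r hr θ hθ => fderivWithin_of_mem_nhds
        (mem_of_superset (closedSector_diff_mem_nhds hβπ hr hθ) sdiff_subset)
    have hsm : ContDiffAt ℝ (⊤ : ℕ∞) u (polarMap r θ) :=
      hu.smooth.contDiffAt (closedSector_diff_mem_nhds hβπ hr hθ)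
    have hdd : HasFDerivAt (fderiv ℝ u) (fderiv ℝ (fderiv ℝ u) (polarMap r θ)) (polarMap r θ) :=
      ((hsm.fderiv_right (m := 1) (by norm_cast)).differentiableAt (by simp)).hasFDerivAt
    set D := fderiv ℝ (fderiv ℝ u) (polarMap r θ)
    have h11 : U₁₁ (r, θ) = D (Complex.exp (Complex.I * θ)) (Complex.exp (Complex.I * θ)) := by
      refine (hd1 r hr θ hθ').1.unique ?_
      have h := (hdd.comp_hasDerivAt (f := fun r => polarMap r θ) r
        (hasDerivAt_polarMap_left r θ)).clm_apply (hasDerivAt_const r (Complex.exp (Complex.I * θ)))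
      refine (h.congr_deriv (by simp)).congr_of_eventuallyEq ?_
      filter_upwards [Ioi_mem_nhds hr] with y hy
      rw [e1 y hy θ hθ', hfd y hy θ hθ]
      rfl
    have h22 : U₂₂ (r, θ) = D (polarMap r θ * Complex.I) (polarMap r θ * Complex.I) +
        fderiv ℝ u (polarMap r θ) (polarMap r θ * Complex.I * Complex.I) := by
      refine ((hd2 r hr θ hθ').2.hasDerivAt (Icc_mem_nhds hθ.1 hθ.2)).unique ?_
      have h := (hdd.comp_hasDerivAt (f := fun θ => polarMap r θ) θ
        (hasDerivAt_polarMap_right r θ)).clm_apply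
          ((hasDerivAt_polarMap_right r θ).mul_const Complex.I)
      refine h.congr_of_eventuallyEq ?_
      filter_upwards [Ioo_mem_nhds hθ.1 hθ.2] with y hy
      rw [e2 r hr y ⟨hy.1.le, hy.2.le⟩, hfd r hr y hy]
      rfl
    have h1 : fderiv ℝ u (polarMap r θ) (polarMap r θ * Complex.I * Complex.I) =
        -(r * U₁ (r, θ)) := by
      rw [e1 r hr θ hθ', hfd r hr θ hθ, mul_assoc, Complex.I_mul_I,
        show polarMap r θ * -1 = (-r) • Complex.exp (Complex.I * θ) by simp [polarMap],
        map_smul, smul_eq_mul, neg_mul]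
    have hl := hu.eigen (polarMap r θ) ⟨r, hr, θ, hθ.1, hθ.2, rfl⟩
    simp only [laplacian, iteratedFDeriv_two_apply] at hl
    have hl' : D 1 1 + D Complex.I Complex.I = -μ * u (polarMap r θ) := by simpa using hl
    have hr' := laplacian_eq_rotated D r θ
    rw [hl'] at hr'
    rw [h22, h1, h11]
    linear_combination hr'

end

/-- The cosine coefficient of a function on `[0, β]` at frequency `m`. -/
def cosCoeff (β m : ℝ) (f : ℝ → ℝ) : ℝ := ∫ θ in (0)..β, f θ * Real.cos (m * θ)

lemma fourierCoeff_even {β : ℝ} (hβ : 0 < β) [Fact (0 < 2 * β)] {f : ℝ → ℝ}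
    (hf : ContinuousOn f (Icc 0 β)) (n : ℤ) :
    fourierCoeff (fun x : AddCircle (2 * β) => (f ‖x‖ : ℂ)) n =
      ((cosCoeff β (n * (Real.pi / β)) f / β : ℝ) : ℂ) := by
  rw [fourierCoeff_eq_intervalIntegral _ n (-β)]
  set h : ℝ → ℂ := fun x => (fourier (-n) : AddCircle (2 * β) → ℂ) x • (f ‖(x : AddCircle (2 * β))‖ : ℂ)
  have hnorm : ∀ x ∈ Icc (-β) β, ‖(x : AddCircle (2 * β))‖ = |x| := fun x hx => by
    rw [AddCircle.norm_coe_eq_abs_iff _ (by positivity), abs_of_pos (by positivity : 0 < 2 * β)]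
    rw [mul_div_cancel_left₀ _ two_ne_zero]
    exact abs_le.2 hx
  have hcont : ContinuousOn h (Icc (-β) β) := by
    refine ContinuousOn.smul (f := fun x : ℝ => (fourier (-n) : AddCircle (2 * β) → ℂ) x)
      (Continuous.continuousOn ?_) ?_
    · exact (fourier (-n) : C(AddCircle (2 * β), ℂ)).continuous.comp (AddCircle.continuous_mk' (2 * β))
    · refine Complex.continuous_ofReal.comp_continuousOn ?_
      refine (hf.comp continuous_abs.continuousOn fun x hx => ⟨abs_nonneg x, abs_le.2 hx⟩).congr ?_
      intro x hx
      simp [hnorm x hx]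
  have hint : ∀ a b : ℝ, a ∈ Icc (-β) β → b ∈ Icc (-β) β → IntervalIntegrable h MeasureTheory.volume a b :=
    fun a b ha hb => (hcont.mono (uIcc_subset_Icc ha hb)).intervalIntegrable
  have m1 : (-β) ∈ Icc (-β) β := ⟨le_rfl, by linarith⟩
  have m2 : (0 : ℝ) ∈ Icc (-β) β := ⟨by linarith, hβ.le⟩
  have m3 : β ∈ Icc (-β) β := ⟨by linarith, le_rfl⟩
  have hneg : ∫ x in (0)..β, h (-x) = ∫ x in (-β)..0, h x := by
    rw [intervalIntegral.integral_comp_neg]; simp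
  have hcn : IntervalIntegrable (fun x => h (-x)) MeasureTheory.volume 0 β := by
    refine ContinuousOn.intervalIntegrable ?_
    rw [uIcc_of_le hβ.le]
    exact hcont.comp (by fun_prop) fun x hx => ⟨by linarith [hx.2], by linarith [hx.1]⟩
  rw [show -β + 2 * β = β by ring]
  change (1 / (2 * β)) • ∫ x in (-β)..β, h x = _
  rw [← intervalIntegral.integral_add_adjacent_intervals (hint _ _ m1 m2) (hint _ _ m2 m3), ← hneg,
    ← intervalIntegral.integral_add hcn (hint _ _ m2 m3)]
  have hpt : ∫ x in (0)..β, (h (-x) + h x) =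
      ∫ x in (0)..β, ((2 * (f x * Real.cos (n * (Real.pi / β) * x)) : ℝ) : ℂ) := by
    refine intervalIntegral.integral_congr fun x hx => ?_
    rw [uIcc_of_le hβ.le] at hx
    have hx1 : x ∈ Icc (-β) β := ⟨by linarith [hx.1], hx.2⟩
    have hx2 : -x ∈ Icc (-β) β := ⟨by linarith [hx.2], by linarith [hx.1]⟩
    simp only [h]
    rw [hnorm x hx1, hnorm (-x) hx2, abs_neg, abs_of_nonneg hx.1, fourier_coe_apply,
      fourier_coe_apply]
    push_cast
    rw [smul_eq_mul, smul_eq_mul, Complex.cos]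
    have hβ' : (β : ℂ) ≠ 0 := by exact_mod_cast hβ.ne'
    have a1 : 2 * (Real.pi : ℂ) * Complex.I * -n * -x / (2 * β) = n * (Real.pi / β) * x * Complex.I := by
      field_simp
    have a2 : 2 * (Real.pi : ℂ) * Complex.I * -n * x / (2 * β) = -(n * (Real.pi / β) * x) * Complex.I := by
      field_simp
    rw [a1, a2]
    ring
  rw [hpt, intervalIntegral.integral_ofReal, intervalIntegral.integral_const_mul, Complex.real_smul,
    ← Complex.ofReal_mul]
  congr 1
  rw [cosCoeff]
  field_simp

/-- Weights of the cosine series on `[0, β]`. -/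
def cosWeight (β : ℝ) (n : ℕ) : ℝ := if n = 0 then 1 / β else 2 / β

lemma hasSum_cos_series {β : ℝ} (hβ : 0 < β) {f : ℝ → ℝ} (hf : ContinuousOn f (Icc 0 β))
    (hs : Summable fun n : ℕ => cosCoeff β (n * (Real.pi / β)) f) {θ : ℝ} (hθ : θ ∈ Icc 0 β) :
    HasSum (fun n : ℕ => cosWeight β n * cosCoeff β (n * (Real.pi / β)) f *
      Real.cos (n * (Real.pi / β) * θ)) (f θ) := by
  have : Fact (0 < 2 * β) := ⟨by positivity⟩
  have hg : Continuous fun x : AddCircle (2 * β) => (f ‖x‖ : ℂ) := by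
    refine Complex.continuous_ofReal.comp (hf.comp_continuous continuous_norm fun x => ?_)
    refine ⟨norm_nonneg x, ?_⟩
    have h := AddCircle.norm_le_half_period (2 * β) (x := x) (by positivity)
    rwa [abs_of_pos (by positivity : 0 < 2 * β), mul_div_cancel_left₀ _ two_ne_zero] at h
  have hco := fourierCoeff_even hβ hf
  have hev : ∀ n : ℤ, cosCoeff β ((-n : ℤ) * (Real.pi / β)) f = cosCoeff β (n * (Real.pi / β)) f := by
    intro n
    simp only [cosCoeff]
    push_cast
    simp only [neg_mul, Real.cos_neg]
  have hsum : Summable (fourierCoeff fun x : AddCircle (2 * β) => (f ‖x‖ : ℂ)) := by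
    have h1 : Summable fun n : ℕ => ((cosCoeff β (n * (Real.pi / β)) f / β : ℝ) : ℂ) :=
      (Complex.ofRealCLM.summable (hs.div_const β))
    refine Summable.of_nat_of_neg ?_ ?_
    · simpa only [hco, Int.cast_natCast] using h1
    · simpa only [hco, hev, Int.cast_natCast] using h1
  have hp := has_pointwise_sum_fourier_series_of_summable
    (f := ⟨fun x : AddCircle (2 * β) => (f ‖x‖ : ℂ), hg⟩) hsum (θ : AddCircle (2 * β))
  have hp2 := hp.nat_add_neg
  have hnorm : ‖(θ : AddCircle (2 * β))‖ = θ := by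
    rw [(AddCircle.norm_coe_eq_abs_iff _ (by positivity)).2, abs_of_nonneg hθ.1]
    rw [abs_of_pos (by positivity : 0 < 2 * β), mul_div_cancel_left₀ _ two_ne_zero,
      abs_of_nonneg hθ.1]
    exact hθ.2
  simp only [ContinuousMap.coe_mk, hco, hnorm, hev, smul_eq_mul] at hp2
  have hterm : ∀ n : ℕ, ((cosCoeff β ((n : ℤ) * (Real.pi / β)) f / β : ℝ) : ℂ) *
      (fourier (n : ℤ) : AddCircle (2 * β) → ℂ) θ +
      ((cosCoeff β ((n : ℤ) * (Real.pi / β)) f / β : ℝ) : ℂ) *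
      (fourier (-(n : ℤ)) : AddCircle (2 * β) → ℂ) θ =
      ((2 / β * cosCoeff β (n * (Real.pi / β)) f * Real.cos (n * (Real.pi / β) * θ) : ℝ) : ℂ) := by
    intro n
    rw [fourier_coe_apply, fourier_coe_apply]
    push_cast
    rw [Complex.cos]
    have hβ' : (β : ℂ) ≠ 0 := by exact_mod_cast hβ.ne'
    have a1 : 2 * (Real.pi : ℂ) * Complex.I * n * θ / (2 * β) = n * (Real.pi / β) * θ * Complex.I := by
      field_simp
    have a2 : 2 * (Real.pi : ℂ) * Complex.I * -n * θ / (2 * β) = -(n * (Real.pi / β) * θ) * Complex.I := by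
      field_simp
    rw [a1, a2]
    ring
  simp only [hterm, fourier_zero, mul_one] at hp2
  rw [← Complex.ofReal_add, Complex.hasSum_ofReal] at hp2
  have h3 := hp2.sub (hasSum_ite_eq 0 (cosCoeff β (((0 : ℤ) : ℝ) * (Real.pi / β)) f / β))
  rw [add_sub_cancel_right] at h3
  refine h3.congr_fun fun n => ?_
  rcases n with _ | n
  · simp [cosWeight]; ring
  · simp [cosWeight]

section

variable {β μ : ℝ} {u : ℂ → ℝ} {U₁ U₁₁ U₂ U₂₂ : ℝ × ℝ → ℝ}

lemma PolarData.integral_second (hP : PolarData β μ u U₁ U₁₁ U₂ U₂₂) (hβ : 0 < β) {m r : ℝ}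
    (hm : Real.sin (m * β) = 0) (hr : 0 < r) :
    ∫ θ in (0)..β, U₂₂ (r, θ) * Real.cos (m * θ) =
      -(m ^ 2 * cosCoeff β m fun θ => u (polarMap r θ)) := by
  have hu : uIcc 0 β = Icc 0 β := uIcc_of_le hβ.le
  have hc : ∀ θ : ℝ, HasDerivAt (fun θ => Real.cos (m * θ)) (-Real.sin (m * θ) * m) θ := fun θ => by
    simpa using (((hasDerivAt_id θ).const_mul m).cos)
  have hs : ∀ θ : ℝ, HasDerivAt (fun θ => Real.sin (m * θ)) (Real.cos (m * θ) * m) θ := fun θ => by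
    simpa using (((hasDerivAt_id θ).const_mul m).sin)
  have hint : ∀ {f : ℝ × ℝ → ℝ}, ContinuousOn f (polarDomain β) →
      IntervalIntegrable (fun θ => f (r, θ)) MeasureTheory.volume 0 β := fun hf => by
    refine ContinuousOn.intervalIntegrable ?_
    rw [hu]
    exact continuousOn_slice hf hr
  have i1 := intervalIntegral.integral_mul_deriv_eq_deriv_mul_of_hasDerivWithinAt
    (a := 0) (b := β) (u := fun θ => Real.cos (m * θ)) (v := fun θ => U₂ (r, θ))
    (fun θ _ => (hc θ).hasDerivWithinAt) (fun θ hθ => by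
      rw [hu] at hθ ⊢; exact hP.deriv₂₂ r hr θ hθ)
    (Continuous.intervalIntegrable (by fun_prop) _ _) (hint hP.cont₂₂)
  have i2 := intervalIntegral.integral_mul_deriv_eq_deriv_mul_of_hasDerivWithinAt
    (a := 0) (b := β) (u := fun θ => Real.sin (m * θ)) (v := fun θ => u (polarMap r θ))
    (fun θ _ => (hs θ).hasDerivWithinAt) (fun θ hθ => by
      rw [hu] at hθ ⊢; exact hP.deriv₂ r hr θ hθ)
    (Continuous.intervalIntegrable (by fun_prop) _ _) (hint hP.cont₂)
  simp only [hP.left r hr, hP.right r hr, hm, mul_zero, Real.sin_zero, zero_mul, sub_zero,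
    zero_sub] at i1 i2
  have e1 : ∫ θ in (0)..β, U₂₂ (r, θ) * Real.cos (m * θ) =
      ∫ θ in (0)..β, Real.cos (m * θ) * U₂₂ (r, θ) := by simp only [mul_comm]
  have e2 : ∫ θ in (0)..β, -Real.sin (m * θ) * m * U₂ (r, θ) =
      -m * ∫ θ in (0)..β, Real.sin (m * θ) * U₂ (r, θ) := by
    rw [← intervalIntegral.integral_const_mul]
    congr 1; ext θ; ring
  have e3 : ∫ θ in (0)..β, Real.cos (m * θ) * m * u (polarMap r θ) =
      m * cosCoeff β m fun θ => u (polarMap r θ) := by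
    rw [cosCoeff, ← intervalIntegral.integral_const_mul]
    congr 1; ext θ; ring
  rw [e1, i1, e2, i2, e3]
  ring

lemma PolarData.radial_equation (hP : PolarData β μ u U₁ U₁₁ U₂ U₂₂) (hβ : 0 < β) {m r : ℝ}
    (hm : Real.sin (m * β) = 0) (hr : 0 < r) :
    HasDerivAt (fun r => cosCoeff β m fun θ => u (polarMap r θ))
      ((r * ∫ θ in (0)..β, U₁ (r, θ) * Real.cos (m * θ)) / r) r ∧
    HasDerivAt (fun r => r * ∫ θ in (0)..β, U₁ (r, θ) * Real.cos (m * θ))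
      ((m ^ 2 / r - 4 * (μ / 4) * r) * cosCoeff β m fun θ => u (polarMap r θ)) r := by
  have hcos : Continuous fun θ => Real.cos (m * θ) := by fun_prop
  constructor
  · rw [mul_div_cancel_left₀ _ hr.ne']
    exact hasDerivAt_integral_mul hβ hP.cont hP.cont₁ hP.deriv₁ hcos hr
  · have h := (hasDerivAt_id r).mul
      (hasDerivAt_integral_mul hβ hP.cont₁ hP.cont₁₁ hP.deriv₁₁ hcos hr)
    refine h.congr_deriv ?_
    have hint : ∀ {f : ℝ × ℝ → ℝ}, ContinuousOn f (polarDomain β) →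
        IntervalIntegrable (fun θ => f (r, θ) * Real.cos (m * θ)) MeasureTheory.volume 0 β :=
      fun hf => by
        refine ContinuousOn.intervalIntegrable ?_
        rw [uIcc_of_le hβ.le]
        exact (continuousOn_slice hf hr).mul hcos.continuousOn
    have e := intervalIntegral.integral_congr_Ioo_of_le (μ := MeasureTheory.volume) hβ.le
      (f := fun θ => r ^ 2 * (U₁₁ (r, θ) * Real.cos (m * θ)) + r * (U₁ (r, θ) * Real.cos (m * θ))
        + U₂₂ (r, θ) * Real.cos (m * θ))
      (g := fun θ => -μ * r ^ 2 * (u (polarMap r θ) * Real.cos (m * θ)))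
      (fun θ hθ => by
        have := hP.polar r hr θ hθ
        simp only
        linear_combination Real.cos (m * θ) * this)
    rw [intervalIntegral.integral_add (((hint hP.cont₁₁).const_mul _).add
      ((hint hP.cont₁).const_mul _)) (hint hP.cont₂₂), intervalIntegral.integral_add
      ((hint hP.cont₁₁).const_mul _) ((hint hP.cont₁).const_mul _)] at e
    simp only [intervalIntegral.integral_const_mul] at e
    rw [hP.integral_second hβ hm hr] at e
    simp only [id, one_mul]
    unfold cosCoeff at e ⊢
    generalize ∫ θ in (0)..β, U₁ (r, θ) * Real.cos (m * θ) = X at *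
    generalize ∫ θ in (0)..β, U₁₁ (r, θ) * Real.cos (m * θ) = Y at *
    generalize ∫ θ in (0)..β, u (polarMap r θ) * Real.cos (m * θ) = Z at *
    have hr0 := hr.ne'
    field_simp
    linear_combination e

end

lemma tendsto_cosCoeff {β μ : ℝ} {u : ℂ → ℝ} (hβ : 0 < β) (hu : IsSectorNeumannEigenfun β u μ)
    (m : ℝ) : Tendsto (fun r => cosCoeff β m fun θ => u (polarMap r θ)) (nhdsWithin 0 (Ioi 0))
      (nhds (u 0 * ∫ θ in (0)..β, Real.cos (m * θ))) := by
  have h0 : (0 : ℂ) ∈ closedSector β := ⟨0, le_rfl, 0, le_rfl, hβ.le, by simp⟩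
  have hcos : Continuous fun θ => Real.cos (m * θ) := by fun_prop
  refine Metric.tendsto_nhds.2 fun ε hε => ?_
  obtain ⟨δ, hδ, hd⟩ := Metric.continuousWithinAt_iff.1 (hu.cont 0 h0) (ε / (2 * β)) (by positivity)
  filter_upwards [Ioo_mem_nhdsGT hδ] with r hr
  have hint : IntervalIntegrable (fun θ => u (polarMap r θ) * Real.cos (m * θ))
      MeasureTheory.volume 0 β := by
    refine ContinuousOn.intervalIntegrable ?_
    rw [uIcc_of_le hβ.le]
    refine ContinuousOn.mul (hu.cont.comp ?_ fun θ hθ => polarMap_mem hr.1.le hθ) hcos.continuousOn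
    unfold polarMap
    fun_prop
  rw [Real.dist_eq, cosCoeff, ← intervalIntegral.integral_const_mul,
    ← intervalIntegral.integral_sub hint (by exact (hcos.const_mul _).intervalIntegrable _ _),
    ← Real.norm_eq_abs]
  refine (intervalIntegral.norm_integral_le_of_norm_le_const (C := ε / (2 * β)) fun θ hθ => ?_).trans_lt ?_
  · rw [uIoc_of_le hβ.le] at hθ
    have h1 := (hd (polarMap_mem hr.1.le ⟨hθ.1.le, hθ.2⟩)
      (by rw [dist_zero_right, norm_polarMap hr.1.le]; exact hr.2)).le
    rw [← sub_mul, norm_mul, ← dist_eq_norm]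
    calc dist (u (polarMap r θ)) (u 0) * ‖Real.cos (m * θ)‖ ≤ ε / (2 * β) * 1 := by
          gcongr
          exact Real.abs_cos_le_one _
      _ = _ := mul_one _
  · rw [sub_zero, abs_of_pos hβ]
    field_simp
    linarith

lemma sin_mul_pi_div {β : ℝ} (hβ : 0 < β) (n : ℕ) : Real.sin (n * (Real.pi / β) * β) = 0 := by
  rw [mul_assoc, div_mul_cancel₀ _ hβ.ne', Real.sin_nat_mul_pi]

lemma integral_cos_eq_zero {β : ℝ} (hβ : 0 < β) {n : ℕ} (hn : n ≠ 0) :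
    ∫ θ in (0)..β, Real.cos (n * (Real.pi / β) * θ) = 0 := by
  have hm : (n : ℝ) * (Real.pi / β) ≠ 0 := by
    have := Real.pi_pos
    positivity
  rw [intervalIntegral.integral_comp_mul_left (fun x => Real.cos x) hm, integral_cos,
    sin_mul_pi_div hβ]
  simp

lemma rpow_nat_mul {x : ℝ} (hx : 0 ≤ x) (ν : ℝ) (n : ℕ) : x ^ ((n : ℝ) * ν) = (x ^ ν) ^ n := by
  rw [mul_comm, Real.rpow_mul hx, Real.rpow_natCast]

lemma exists_expansion {β μ : ℝ} {u : ℂ → ℝ} (hβ : 0 < β) (hβπ : β < Real.pi) (hμ : 0 < μ)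
    (hu : IsSectorNeumannEigenfun β u μ) :
    ∃ R K : ℝ, ∃ A : ℕ → ℝ, 0 < R ∧ μ / 4 * R ^ 2 ≤ 1 / 4 ∧
      (∀ n : ℕ, |A n| * R ^ (n * (Real.pi / β)) ≤ K) ∧
      (∀ r ∈ Ioo 0 R, ∀ θ ∈ Icc 0 β, HasSum (fun n : ℕ => A n *
        radialSol (μ / 4) (n * (Real.pi / β)) r * Real.cos (n * (Real.pi / β) * θ))
        (u (polarMap r θ))) ∧
      A 0 = u 0 ∧ ((∀ n, A n = 0) → ∀ z ∈ closedSector β, u z = 0) := by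
  have hpi := Real.pi_pos
  obtain ⟨U₁, U₁₁, U₂, U₂₂, hP⟩ := exists_polarData hβ hβπ hu
  set ν := Real.pi / β with hν
  have hν0 : 0 < ν := by positivity
  set R : ℝ := 1 / Real.sqrt μ with hR
  have hs : 0 < Real.sqrt μ := Real.sqrt_pos.2 hμ
  have hR0 : 0 < R := by positivity
  have hRle : μ / 4 * R ^ 2 ≤ 1 / 4 := by
    rw [hR, div_pow, Real.sq_sqrt hμ.le]; field_simp; rfl
  set a : ℕ → ℝ → ℝ := fun n r => cosCoeff β (n * ν) fun θ => u (polarMap r θ)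
  have hm0 : ∀ n : ℕ, 0 ≤ (n : ℝ) * ν := fun n => by positivity
  have hlim0 : ∀ n : ℕ, (n : ℝ) * ν = 0 ∨ (u 0 * ∫ θ in (0)..β, Real.cos (n * ν * θ)) = 0 := by
    intro n
    rcases eq_or_ne n 0 with rfl | hn
    · left; simp
    · right; rw [integral_cos_eq_zero hβ hn, mul_zero]
  have hrad := fun (n : ℕ) (r : ℝ) (hr : 0 < r) =>
    hP.radial_equation hβ (sin_mul_pi_div hβ n) hr
  have hex : ∀ n : ℕ, ∃ C, ∀ r ∈ Ioc 0 R, a n r = C * radialSol (μ / 4) (n * ν) r := fun n =>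
    exists_eq_mul_radialSol (by positivity) (hm0 n) hR0 hRle (fun r hr => (hrad n r hr).1)
      (fun r hr => (hrad n r hr).2) (tendsto_cosCoeff hβ hu _) (hlim0 n)
  choose C hC using hex
  have hslice : ∀ r, 0 < r → ContinuousOn (fun θ => u (polarMap r θ)) (Icc 0 β) := fun r hr =>
    continuousOn_slice hP.cont hr
  obtain ⟨M, hM⟩ := isCompact_Icc.exists_bound_of_continuousOn (hslice R hR0)
  have hM0 : 0 ≤ M := (norm_nonneg _).trans (hM 0 ⟨le_rfl, hβ.le⟩)
  have haR : ∀ n, |a n R| ≤ M * β := fun n => by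
    have h := intervalIntegral.norm_integral_le_of_norm_le_const (a := 0) (b := β) (C := M)
      (f := fun θ => u (polarMap R θ) * Real.cos (n * ν * θ)) fun θ hθ => by
        rw [uIoc_of_le hβ.le] at hθ
        rw [norm_mul]
        calc ‖u (polarMap R θ)‖ * ‖Real.cos (n * ν * θ)‖ ≤ M * 1 := by
              gcongr
              · exact hM θ ⟨hθ.1.le, hθ.2⟩
              · exact Real.abs_cos_le_one _
          _ = M := mul_one _
    rwa [sub_zero, abs_of_pos hβ] at h
  have hCb : ∀ n, |C n| * R ^ (n * ν) ≤ 2 * (M * β) := fun n => by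
    have h1 := haR n
    rw [hC n R ⟨hR0, le_rfl⟩, abs_mul] at h1
    have h2 := (radialSol_bounds (κ := μ / 4) (by positivity) (hm0 n) hRle hR0 le_rfl).1
    have h3 := h2.trans (le_abs_self _)
    have h4 := mul_le_mul_of_nonneg_left h3 (abs_nonneg (C n))
    linarith
  have hab : ∀ r ∈ Ioo 0 R, Summable fun n => a n r := by
    intro r hr
    have hq : (r / R) ^ ν < 1 := Real.rpow_lt_one (by have := hr.1; positivity)
      ((div_lt_one hR0).2 hr.2) hν0
    have hq0 : 0 ≤ (r / R) ^ ν := by have := hr.1; positivity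
    refine Summable.of_norm_bounded (g := fun n => 4 * (M * β) * ((r / R) ^ ν) ^ n)
      ((summable_geometric_of_lt_one hq0 hq).mul_left _) fun n => ?_
    have h2 := radialSol_bounds (κ := μ / 4) (by positivity) (hm0 n) hRle hr.1 hr.2.le
    have hrm : 0 ≤ r ^ (n * ν) := Real.rpow_nonneg hr.1.le _
    rw [hC n r ⟨hr.1, hr.2.le⟩, Real.norm_eq_abs, abs_mul,
      abs_of_nonneg (a := radialSol _ _ _) (by linarith [h2.1]), ← rpow_nat_mul
        (by have := hr.1; positivity), Real.div_rpow hr.1.le hR0.le,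
      mul_div_assoc' (4 * (M * β)), le_div_iff₀ (by positivity)]
    calc |C n| * radialSol (μ / 4) (n * ν) r * R ^ (n * ν)
        = (|C n| * R ^ (n * ν)) * radialSol (μ / 4) (n * ν) r := by ring
      _ ≤ 2 * (M * β) * (2 * r ^ (n * ν)) :=
          mul_le_mul (hCb n) h2.2 (by linarith [h2.1]) (by positivity)
      _ = _ := by ring
  refine ⟨R, 2 / β * (2 * (M * β)), fun n => cosWeight β n * C n, hR0, hRle, fun n => ?_,
    fun r hr θ hθ => ?_, ?_, fun hz => ?_⟩
  · have hw : |cosWeight β n| ≤ 2 / β := by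
      rw [cosWeight]
      split_ifs
      · rw [abs_of_pos (by positivity)]; gcongr; norm_num
      · rw [abs_of_pos (by positivity)]
    rw [abs_mul, mul_assoc]
    exact mul_le_mul hw (hCb n) (by positivity) (by positivity)
  · refine (hasSum_cos_series hβ (hslice r hr.1) (hab r hr) hθ).congr_fun fun n => ?_
    change _ = cosWeight β n * a n r * _
    rw [hC n r ⟨hr.1, hr.2.le⟩, mul_assoc (cosWeight β n)]
  · have h1 := tendsto_cosCoeff hβ hu ((0 : ℕ) * ν)
    have h2 : Tendsto (radialSol (μ / 4) ((0 : ℕ) * ν)) (nhdsWithin 0 (Ioi 0)) (nhds 1) := by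
      have hc : Continuous fun r : ℝ => besselFactor 0 (μ / 4 * r ^ 2) :=
        (continuous_besselFactor le_rfl).comp (by fun_prop)
      have := (hc.tendsto 0).mono_left (nhdsWithin_le_nhds (s := Ioi 0))
      simp only [ne_eq, OfNat.ofNat_ne_zero, not_false_eq_true, zero_pow, mul_zero,
        besselFactor_zero le_rfl] at this
      refine this.congr fun r => ?_
      simp [radialSol]
    have h3 : Tendsto (fun r => cosCoeff β ((0 : ℕ) * ν) fun θ => u (polarMap r θ))
        (nhdsWithin 0 (Ioi 0)) (nhds (C 0)) := by
      have h4 := h2.const_mul (C 0)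
      rw [mul_one] at h4
      refine h4.congr' ?_
      filter_upwards [Ioc_mem_nhdsGT hR0] with r hr using (hC 0 r hr).symm
    have h4 := tendsto_nhds_unique h3 h1
    simp only [h4, cosWeight, if_true, Nat.cast_zero, zero_mul, Real.cos_zero,
      intervalIntegral.integral_const, sub_zero, smul_eq_mul, mul_one]
    field_simp
  · have hC0 : ∀ n, C n = 0 := fun n => by
      refine (mul_eq_zero.1 (hz n)).resolve_left ?_
      rw [cosWeight]
      split_ifs <;> positivity
    have ha0 : ∀ n r, 0 < r → a n r = 0 := fun n r hr =>
      radial_eq_zero hR0 (fun r hr => (hrad n r hr).1) (fun r hr => (hrad n r hr).2)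
        (fun r hr => by rw [← zero_mul, ← hC0 n]; exact hC n r hr) hr
    have hpos : ∀ r, 0 < r → ∀ θ ∈ Icc 0 β, u (polarMap r θ) = 0 := fun r hr θ hθ => by
      have hz' : ∀ n : ℕ, cosCoeff β (n * (Real.pi / β)) (fun θ => u (polarMap r θ)) = 0 :=
        fun n => ha0 n r hr
      have h := hasSum_cos_series hβ (hslice r hr) (by simpa only [hz'] using summable_zero) hθ
      simp only [hz', mul_zero, zero_mul] at h
      exact h.unique hasSum_zero
    have hzero : u 0 = 0 := by
      have hc : ContinuousWithinAt (fun r => u (polarMap r 0)) (Ici 0) 0 := by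
        have h0 : polarMap 0 0 = 0 := by simp [polarMap]
        refine ContinuousWithinAt.comp (t := closedSector β) (g := u) (f := fun r => polarMap r 0) ?_ ?_
          fun r hr => polarMap_mem hr ⟨le_rfl, hβ.le⟩
        · exact hu.cont _ (polarMap_mem le_rfl ⟨le_rfl, hβ.le⟩)
        · unfold polarMap; fun_prop
      have h1 := (hc.mono Ioi_subset_Ici_self).tendsto
      have h2 : Tendsto (fun r => u (polarMap r 0)) (nhdsWithin 0 (Ioi 0)) (nhds 0) := by
        refine tendsto_const_nhds.congr' ?_
        filter_upwards [self_mem_nhdsWithin] with r hr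
          using (hpos r hr 0 ⟨le_rfl, hβ.le⟩).symm
      have := tendsto_nhds_unique h1 h2
      simpa [polarMap] using this
    rintro z ⟨r, hr, θ, h0, h1, rfl⟩
    rcases hr.eq_or_lt with rfl | hr
    · simpa using hzero
    · exact hpos r hr θ ⟨h0, h1⟩

lemma summable_coeff {A : ℕ → ℝ} {K R ν ρ : ℝ} (hν : 0 < ν) (hρ : 0 < ρ) (hρR : ρ < R)
    (hA : ∀ n : ℕ, |A n| * R ^ (n * ν) ≤ K) :
    Summable fun n : ℕ => |A n| * ρ ^ (n * ν) * (n * ν + 1) ^ 2 := by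
  have hR : 0 < R := hρ.trans hρR
  set q := (ρ / R) ^ ν
  have hq1 : q < 1 := Real.rpow_lt_one (by positivity) ((div_lt_one hR).2 hρR) hν
  have hq0 : 0 ≤ q := by positivity
  have hqn : ‖q‖ < 1 := by rwa [Real.norm_of_nonneg hq0]
  have hg := fun k => summable_pow_mul_geometric_of_norm_lt_one k hqn
  have hs : Summable fun n : ℕ => K * (q ^ n * (n * ν + 1) ^ 2) := by
    refine Summable.mul_left K ?_
    refine ((((hg 2).mul_left (ν ^ 2)).add ((hg 1).mul_left (2 * ν))).add (hg 0)).congr fun n => ?_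
    ring
  refine Summable.of_nonneg_of_le (fun n => by positivity) (fun n => ?_) hs
  rw [← mul_assoc]
  refine mul_le_mul_of_nonneg_right ?_ (by positivity)
  have e : ρ ^ (n * ν) = q ^ n * R ^ (n * ν) := by
    rw [← rpow_nat_mul (by positivity), Real.div_rpow hρ.le hR.le, div_mul_cancel₀ _ (by positivity)]
  calc |A n| * ρ ^ (n * ν) = (|A n| * R ^ (n * ν)) * q ^ n := by rw [e]; ring
    _ ≤ K * q ^ n := by
        gcongr
        exact hA n

/-- The angular profile of the `L_ψ`-derivative of the `m`-th mode. -/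
def modeDeriv (κ ψ m r θ : ℝ) : ℝ :=
  eulerFactor m (κ * r ^ 2) * (Real.cos (θ - ψ) * Real.cos (m * θ)) +
    m * besselFactor m (κ * r ^ 2) * (Real.sin (θ - ψ) * Real.sin (m * θ))

section

variable {β μ R K : ℝ} {u : ℂ → ℝ} {A : ℕ → ℝ}

lemma hasSum_radial_deriv (hβ : 0 < β) (hμ : 0 < μ) (hu : IsSectorNeumannEigenfun β u μ)
    (hR : μ / 4 * R ^ 2 ≤ 1 / 4) (hA : ∀ n : ℕ, |A n| * R ^ (n * (Real.pi / β)) ≤ K)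
    (hS : ∀ r ∈ Ioo 0 R, ∀ θ ∈ Icc 0 β, HasSum (fun n : ℕ => A n *
        radialSol (μ / 4) (n * (Real.pi / β)) r * Real.cos (n * (Real.pi / β) * θ))
        (u (polarMap r θ))) {r θ : ℝ} (hr : r ∈ Ioo 0 R) (hθ : θ ∈ Icc 0 β) :
    HasSum (fun n : ℕ => A n * (r ^ (n * (Real.pi / β)) *
      eulerFactor (n * (Real.pi / β)) (μ / 4 * r ^ 2) / r) * Real.cos (n * (Real.pi / β) * θ))
      (fderivWithin ℝ u (closedSector β) (polarMap r θ) (Complex.exp (Complex.I * θ))) := by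
  have hpi := Real.pi_pos
  have hr0 := hr.1
  set ν := Real.pi / β with hν
  have hν0 : 0 < ν := by positivity
  obtain ⟨ρ, hrρ, hρR⟩ := exists_between hr.2
  have hsum := (summable_coeff hν0 (hr.1.trans hrρ) hρR hA).mul_left (2 / (r / 2))
  have hmem : r ∈ Ioo (r / 2) ρ := ⟨by linarith [hr.1], hrρ⟩
  have hbound : ∀ n : ℕ, ∀ s ∈ Ioo (r / 2) ρ, ‖A n * (s ^ (n * ν) *
      eulerFactor (n * ν) (μ / 4 * s ^ 2) / s) * Real.cos (n * ν * θ)‖ ≤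
      2 / (r / 2) * (|A n| * ρ ^ (n * ν) * (n * ν + 1) ^ 2) := by
    intro n s hs
    have hm : 0 ≤ (n : ℝ) * ν := by positivity
    have hs0 : 0 < s := by linarith [hs.1]
    have hsR : μ / 4 * s ^ 2 ≤ 1 / 4 := by
      refine le_trans ?_ hR
      gcongr
      exact (hs.2.trans hρR).le
    have h1 := abs_eulerFactor_le hm (by positivity) hsR
    have h2 := Real.abs_cos_le_one (n * ν * θ)
    have h3 : s ^ (n * ν) ≤ ρ ^ (n * ν) := Real.rpow_le_rpow hs0.le hs.2.le hm
    rw [norm_mul, norm_mul, norm_div, norm_mul, Real.norm_eq_abs, Real.norm_eq_abs, Real.norm_eq_abs,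
      Real.norm_eq_abs, Real.norm_eq_abs, abs_of_pos hs0, abs_of_nonneg (a := s ^ (n * ν)) (by positivity)]
    calc |A n| * (s ^ (n * ν) * |eulerFactor (n * ν) (μ / 4 * s ^ 2)| / s) * |Real.cos (n * ν * θ)|
        ≤ |A n| * (ρ ^ (n * ν) * (2 * (n * ν + 1) ^ 2) / (r / 2)) * 1 := by
          have h4 : |eulerFactor (n * ν) (μ / 4 * s ^ 2)| ≤ 2 * (n * ν + 1) ^ 2 :=
            h1.trans (by nlinarith)
          have h5 := hs.1.le
          have h6 : 0 < ρ := hr0.trans hrρ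
          gcongr
      _ = _ := by ring
  have hder : ∀ n : ℕ, ∀ s ∈ Ioo (r / 2) ρ, HasDerivAt (fun s => A n * radialSol (μ / 4) (n * ν) s *
      Real.cos (n * ν * θ)) (A n * (s ^ (n * ν) *
      eulerFactor (n * ν) (μ / 4 * s ^ 2) / s) * Real.cos (n * ν * θ)) s := fun n s hs =>
    ((hasDerivAt_radialSol (by positivity) (by linarith [hs.1])).const_mul (A n)).mul_const _
  have hd := hasDerivAt_tsum_of_isPreconnected hsum isOpen_Ioo isPreconnected_Ioo hder hbound hmem
    (hS r hr θ hθ).summable hmem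
  have hd2 : HasDerivAt (fun s => u (polarMap s θ)) (∑' n : ℕ, A n * (r ^ (n * ν) *
      eulerFactor (n * ν) (μ / 4 * r ^ 2) / r) * Real.cos (n * ν * θ)) r := by
    refine hd.congr_of_eventuallyEq ?_
    filter_upwards [Ioo_mem_nhds hr.1 hr.2] with s hs using (hS s hs θ hθ).tsum_eq.symm
  rw [(hasDerivAt_sector_left hu hr.1 hθ).unique hd2]
  exact (Summable.of_norm_bounded hsum fun n => hbound n r hmem).hasSum

lemma hasSum_angular_deriv (hβ : 0 < β) (hμ : 0 < μ) (hu : IsSectorNeumannEigenfun β u μ)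
    (hR : μ / 4 * R ^ 2 ≤ 1 / 4) (hA : ∀ n : ℕ, |A n| * R ^ (n * (Real.pi / β)) ≤ K)
    (hS : ∀ r ∈ Ioo 0 R, ∀ θ ∈ Icc 0 β, HasSum (fun n : ℕ => A n *
        radialSol (μ / 4) (n * (Real.pi / β)) r * Real.cos (n * (Real.pi / β) * θ))
        (u (polarMap r θ))) {r θ : ℝ} (hr : r ∈ Ioo 0 R) (hθ : θ ∈ Icc 0 β) :
    HasSum (fun n : ℕ => A n * radialSol (μ / 4) (n * (Real.pi / β)) r *
      (-Real.sin (n * (Real.pi / β) * θ) * (n * (Real.pi / β))))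
      (fderivWithin ℝ u (closedSector β) (polarMap r θ) (polarMap r θ * Complex.I)) := by
  have hpi := Real.pi_pos
  have hr0 := hr.1
  set ν := Real.pi / β with hν
  have hν0 : 0 < ν := by positivity
  have hsum := (summable_coeff hν0 hr.1 hr.2 hA).mul_left 2
  have hbound : ∀ n : ℕ, ∀ t : ℝ, ‖A n * radialSol (μ / 4) (n * ν) r *
      (-Real.sin (n * ν * t) * (n * ν))‖ ≤
      2 * (|A n| * r ^ (n * ν) * (n * ν + 1) ^ 2) := by
    intro n t
    have hm : 0 ≤ (n : ℝ) * ν := by positivity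
    have h1 := radialSol_bounds (κ := μ / 4) (by positivity) hm hR hr.1 hr.2.le
    have h0 : 0 ≤ radialSol (μ / 4) (n * ν) r :=
      le_trans (by positivity) h1.1
    have h2 := Real.abs_sin_le_one (n * ν * t)
    rw [norm_mul, norm_mul, norm_mul, norm_neg, Real.norm_eq_abs, Real.norm_eq_abs,
      Real.norm_eq_abs, Real.norm_eq_abs, abs_of_nonneg h0, abs_of_nonneg hm]
    calc |A n| * radialSol (μ / 4) (n * ν) r * (|Real.sin (n * ν * t)| * (n * ν))
        ≤ |A n| * (2 * r ^ (n * ν)) * (1 * (n * ν + 1) ^ 2) := by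
          gcongr
          · exact h1.2
          · nlinarith
      _ = _ := by ring
  have hder : ∀ n : ℕ, ∀ t : ℝ, HasDerivAt (fun t => A n * radialSol (μ / 4) (n * ν) r *
      Real.cos (n * ν * t)) (A n * radialSol (μ / 4) (n * ν) r *
      (-Real.sin (n * ν * t) * (n * ν))) t := fun n t => by
    have h : HasDerivAt (fun t => Real.cos (n * ν * t)) (-Real.sin (n * ν * t) * (n * ν)) t := by
      simpa using (((hasDerivAt_id t).const_mul (n * ν)).cos)
    exact h.const_mul _
  have hd := hasDerivAt_tsum hsum hder hbound (hS r hr θ hθ).summable θ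
  have hd2 : HasDerivWithinAt (fun t => u (polarMap r t)) (∑' n : ℕ, A n * radialSol (μ / 4) (n * ν) r *
      (-Real.sin (n * ν * θ) * (n * ν))) (Icc 0 β) θ :=
    hd.hasDerivWithinAt.congr_of_mem (fun t ht => (hS r hr t ht).tsum_eq.symm) hθ
  rw [(uniqueDiffOn_Icc hβ θ hθ).eq_deriv _ (hasDerivWithinAt_sector_right hu hr.1 hθ) hd2]
  exact (Summable.of_norm_bounded hsum fun n => hbound n θ).hasSum

lemma mul_Lpsi_eq (ψ : ℝ) (r θ : ℝ) :
    r * Lpsi β u ψ (polarMap r θ) =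
      r * Real.cos (θ - ψ) * fderivWithin ℝ u (closedSector β) (polarMap r θ)
        (Complex.exp (Complex.I * θ)) - Real.sin (θ - ψ) *
        fderivWithin ℝ u (closedSector β) (polarMap r θ) (polarMap r θ * Complex.I) := by
  rw [Lpsi, ← smul_eq_mul r, ← smul_eq_mul (r * _), ← smul_eq_mul (Real.sin _), ← map_smul,
    ← map_smul, ← map_smul, ← map_sub]
  congr 1
  rw [polarMap, mul_comm Complex.I (θ : ℂ), Complex.exp_mul_I, ← Complex.ofReal_cos,
    ← Complex.ofReal_sin, Real.cos_sub, Real.sin_sub]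
  have h := Real.sin_sq_add_cos_sq θ
  apply Complex.ext
  · simp [-Complex.ofReal_cos, -Complex.ofReal_sin]
    linear_combination -(r * Real.cos ψ) * h
  · simp [-Complex.ofReal_cos, -Complex.ofReal_sin]
    linear_combination -(r * Real.sin ψ) * h

lemma hasSum_mul_Lpsi (hβ : 0 < β) (hμ : 0 < μ) (hu : IsSectorNeumannEigenfun β u μ)
    (hR : μ / 4 * R ^ 2 ≤ 1 / 4) (hA : ∀ n : ℕ, |A n| * R ^ (n * (Real.pi / β)) ≤ K)
    (hS : ∀ r ∈ Ioo 0 R, ∀ θ ∈ Icc 0 β, HasSum (fun n : ℕ => A n *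
        radialSol (μ / 4) (n * (Real.pi / β)) r * Real.cos (n * (Real.pi / β) * θ))
        (u (polarMap r θ))) (ψ : ℝ) {r θ : ℝ} (hr : r ∈ Ioo 0 R) (hθ : θ ∈ Icc 0 β) :
    HasSum (fun n : ℕ => A n * r ^ (n * (Real.pi / β)) *
      modeDeriv (μ / 4) ψ (n * (Real.pi / β)) r θ) (r * Lpsi β u ψ (polarMap r θ)) := by
  rw [mul_Lpsi_eq]
  refine (((hasSum_radial_deriv hβ hμ hu hR hA hS hr hθ).mul_left (r * Real.cos (θ - ψ))).sub
    ((hasSum_angular_deriv hβ hμ hu hR hA hS hr hθ).mul_left (Real.sin (θ - ψ)))).congr_fun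
    fun n => ?_
  have := hr.1.ne'
  rw [modeDeriv, radialSol]
  field_simp
  ring

end

section

variable {A e b : ℕ → ℝ} {N : ℕ} {ρ : ℝ} {τ τ' : ℕ → ℝ → ℝ → ℝ}

lemma abs_leading_term_le (hρ : 0 < ρ) (hN : ∀ n, n ≠ N → A n ≠ 0 → e N < e n) (n : ℕ) {r t : ℝ}
    (hr : r ∈ Icc 0 ρ) (ht : |t| ≤ b n) :
    ‖A n * r ^ (e n - e N) * t‖ ≤ ρ ^ (-e N) * (|A n| * ρ ^ e n * b n) := by
  by_cases hA : A n = 0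
  · simp [hA]
  have he : 0 ≤ e n - e N := by
    rcases eq_or_ne n N with rfl | hn
    · simp
    · exact sub_nonneg.2 (hN n hn hA).le
  have hb : 0 ≤ b n := (abs_nonneg t).trans ht
  rw [norm_mul, norm_mul, Real.norm_eq_abs, Real.norm_eq_abs, Real.norm_eq_abs,
    abs_of_nonneg (Real.rpow_nonneg hr.1 _)]
  calc |A n| * r ^ (e n - e N) * |t| ≤ |A n| * ρ ^ (e n - e N) * b n := by
        have := Real.rpow_le_rpow hr.1 hr.2 he
        gcongr
    _ = _ := by rw [sub_eq_add_neg, Real.rpow_add hρ]; ring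

lemma continuousOn_leading (hρ : 0 < ρ) (hN : ∀ n, n ≠ N → A n ≠ 0 → e N < e n)
    (hs : Summable fun n => |A n| * ρ ^ e n * b n)
    (hb : ∀ n, ∀ r ∈ Icc 0 ρ, ∀ θ, |τ n r θ| ≤ b n)
    (hτ : ∀ n, Continuous fun p : ℝ × ℝ => τ n p.1 p.2) :
    ContinuousOn (fun p : ℝ × ℝ => ∑' n, A n * p.1 ^ (e n - e N) * τ n p.1 p.2)
      (Icc 0 ρ ×ˢ univ) := by
  refine continuousOn_tsum (fun n => ?_) (hs.mul_left (ρ ^ (-e N)))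
    fun n p hp => abs_leading_term_le hρ hN n hp.1 (hb n _ hp.1 _)
  by_cases hA : A n = 0
  · simp only [hA, zero_mul]
    exact continuousOn_const
  have he : 0 ≤ e n - e N := by
    rcases eq_or_ne n N with rfl | hn
    · simp
    · exact sub_nonneg.2 (hN n hn hA).le
  exact ((continuous_const.mul (continuous_fst.rpow_const fun _ => Or.inr he)).mul
    (hτ n)).continuousOn

lemma hasDerivAt_leading (hρ : 0 < ρ) (hN : ∀ n, n ≠ N → A n ≠ 0 → e N < e n)
    (hs : Summable fun n => |A n| * ρ ^ e n * b n)
    (hb : ∀ n, ∀ r ∈ Icc 0 ρ, ∀ θ, |τ n r θ| ≤ b n)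
    (hb' : ∀ n, ∀ r ∈ Icc 0 ρ, ∀ θ, |τ' n r θ| ≤ b n)
    (hd : ∀ n r θ, HasDerivAt (fun θ => τ n r θ) (τ' n r θ) θ) {r : ℝ} (hr : r ∈ Icc 0 ρ) (θ : ℝ) :
    HasDerivAt (fun θ => ∑' n, A n * r ^ (e n - e N) * τ n r θ)
      (∑' n, A n * r ^ (e n - e N) * τ' n r θ) θ :=
  hasDerivAt_tsum (hs.mul_left (ρ ^ (-e N))) (fun n θ => (hd n r θ).const_mul _)
    (fun n θ => abs_leading_term_le hρ hN n hr (hb' n r hr θ))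
    (Summable.of_norm_bounded (hs.mul_left (ρ ^ (-e N)))
      fun n => abs_leading_term_le hρ hN n hr (hb n r hr θ)) θ

lemma tsum_leading_zero (hN : ∀ n, n ≠ N → A n ≠ 0 → e N < e n) (t : ℕ → ℝ) :
    ∑' n, A n * (0 : ℝ) ^ (e n - e N) * t n = A N * t N := by
  rw [tsum_eq_single N fun n hn => ?_]
  · simp
  · by_cases hA : A n = 0
    · simp [hA]
    · rw [Real.zero_rpow (sub_pos.2 (hN n hn hA)).ne']; simp

end

/-- The exponent of the leading power in the `L_ψ`-derivative of the `n`-th mode. -/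
def modeExp (ν : ℝ) (n : ℕ) : ℝ := if n = 0 then 2 else n * ν

/-- The `L_ψ`-derivative of the `n`-th mode, divided by its leading power of the radius. -/
def modeProfile (κ ν ψ : ℝ) (n : ℕ) (r θ : ℝ) : ℝ :=
  if n = 0 then -(2 * κ * besselFactor 1 (κ * r ^ 2)) * Real.cos (θ - ψ)
  else modeDeriv κ ψ (n * ν) r θ

/-- The angular derivative of `modeProfile`. -/
def modeProfileDeriv (κ ν ψ : ℝ) (n : ℕ) (r θ : ℝ) : ℝ :=
  if n = 0 then 2 * κ * besselFactor 1 (κ * r ^ 2) * Real.sin (θ - ψ)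
  else eulerFactor (n * ν) (κ * r ^ 2) *
      (-Real.sin (θ - ψ) * Real.cos (n * ν * θ) - Real.cos (θ - ψ) * (Real.sin (n * ν * θ) * (n * ν))) +
    n * ν * besselFactor (n * ν) (κ * r ^ 2) *
      (Real.cos (θ - ψ) * Real.sin (n * ν * θ) + Real.sin (θ - ψ) * (Real.cos (n * ν * θ) * (n * ν)))

lemma rpow_mul_modeDeriv {κ ν ψ r θ : ℝ} (n : ℕ) :
    r ^ (n * ν) * modeDeriv κ ψ (n * ν) r θ =
      r ^ modeExp ν n * modeProfile κ ν ψ n r θ := by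
  by_cases hn : n = 0
  · subst hn
    have h2 : r ^ (2 : ℝ) = r ^ 2 := by norm_cast
    simp [modeExp, modeProfile, modeDeriv, eulerFactor, h2]
    ring
  · simp [modeExp, modeProfile, hn]

lemma continuous_modeProfile {κ ν ψ : ℝ} (hν : 0 < ν) (n : ℕ) :
    Continuous fun p : ℝ × ℝ => modeProfile κ ν ψ n p.1 p.2 := by
  have hb := fun {m : ℝ} (hm : 0 ≤ m) => (continuous_besselFactor hm).comp
    (by fun_prop : Continuous fun p : ℝ × ℝ => κ * p.1 ^ 2)
  have he := fun {m : ℝ} (hm : 0 ≤ m) => (continuous_eulerFactor hm).comp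
    (by fun_prop : Continuous fun p : ℝ × ℝ => κ * p.1 ^ 2)
  simp only [Function.comp_def] at hb he
  unfold modeProfile modeDeriv
  split_ifs
  · have := hb zero_le_one
    fun_prop
  · have h1 := hb (m := n * ν) (by positivity)
    have h2 := he (m := n * ν) (by positivity)
    fun_prop

lemma continuous_modeProfileDeriv {κ ν ψ : ℝ} (hν : 0 < ν) (n : ℕ) :
    Continuous fun p : ℝ × ℝ => modeProfileDeriv κ ν ψ n p.1 p.2 := by
  have hb := fun {m : ℝ} (hm : 0 ≤ m) => (continuous_besselFactor hm).comp
    (by fun_prop : Continuous fun p : ℝ × ℝ => κ * p.1 ^ 2)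
  have he := fun {m : ℝ} (hm : 0 ≤ m) => (continuous_eulerFactor hm).comp
    (by fun_prop : Continuous fun p : ℝ × ℝ => κ * p.1 ^ 2)
  simp only [Function.comp_def] at hb he
  unfold modeProfileDeriv
  split_ifs
  · have := hb zero_le_one
    fun_prop
  · have h1 := hb (m := n * ν) (by positivity)
    have h2 := he (m := n * ν) (by positivity)
    fun_prop

lemma hasDerivAt_modeProfile (κ ν ψ : ℝ) (n : ℕ) (r θ : ℝ) :
    HasDerivAt (fun θ => modeProfile κ ν ψ n r θ) (modeProfileDeriv κ ν ψ n r θ) θ := by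
  have h1 : HasDerivAt (fun θ => Real.cos (θ - ψ)) (-Real.sin (θ - ψ)) θ := by
    simpa using ((hasDerivAt_id θ).sub_const ψ).cos
  have h2 : HasDerivAt (fun θ => Real.sin (θ - ψ)) (Real.cos (θ - ψ)) θ := by
    simpa using ((hasDerivAt_id θ).sub_const ψ).sin
  have h3 : HasDerivAt (fun θ => Real.cos (n * ν * θ)) (-Real.sin (n * ν * θ) * (n * ν)) θ := by
    simpa using ((hasDerivAt_id θ).const_mul (n * ν)).cos
  have h4 : HasDerivAt (fun θ => Real.sin (n * ν * θ)) (Real.cos (n * ν * θ) * (n * ν)) θ := by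
    simpa using ((hasDerivAt_id θ).const_mul (n * ν)).sin
  unfold modeProfile modeProfileDeriv modeDeriv
  split_ifs
  · exact (h1.const_mul _).congr_deriv (by ring)
  · exact (((h1.mul h3).const_mul _).add ((h2.mul h4).const_mul _)).congr_deriv (by ring)

/-- A bound for `modeProfile` and `modeProfileDeriv`. -/
def modeBound (κ ν : ℝ) (n : ℕ) : ℝ := (4 * κ + 4) * (n * ν + 1) ^ 2

lemma abs_modeProfile_le {κ ν ψ ρ r : ℝ} (hκ : 0 < κ) (hν : 0 < ν) (hρ : κ * ρ ^ 2 ≤ 1 / 4) (n : ℕ)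
    (hr : r ∈ Icc 0 ρ) (θ : ℝ) : |modeProfile κ ν ψ n r θ| ≤ modeBound κ ν n ∧
      |modeProfileDeriv κ ν ψ n r θ| ≤ modeBound κ ν n := by
  have h0 : 0 ≤ κ * r ^ 2 := by positivity
  have h1 : κ * r ^ 2 ≤ 1 / 4 := le_trans (by have := hr.1; have := hr.2; gcongr) hρ
  have hm : 0 ≤ (n : ℝ) * ν := by positivity
  have c1 := Real.abs_cos_le_one (θ - ψ)
  have s1 := Real.abs_sin_le_one (θ - ψ)
  have c2 := Real.abs_cos_le_one (n * ν * θ)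
  have s2 := Real.abs_sin_le_one (n * ν * θ)
  unfold modeProfile modeProfileDeriv modeBound modeDeriv
  split_ifs with hn
  · subst hn
    have hb := abs_besselFactor_le_two zero_le_one h0 h1
    have : |2 * κ * besselFactor 1 (κ * r ^ 2)| ≤ 4 * κ := by
      rw [abs_mul, abs_of_pos (by positivity)]
      nlinarith
    simp only [Nat.cast_zero, zero_mul, zero_add, one_pow, mul_one]
    constructor
    · rw [abs_mul, abs_neg]
      calc _ ≤ 4 * κ * 1 := by gcongr
        _ ≤ _ := by linarith
    · rw [abs_mul]
      calc _ ≤ 4 * κ * 1 := by gcongr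
        _ ≤ _ := by linarith
  · set m := (n : ℝ) * ν
    have hb := abs_besselFactor_le_two hm h0 h1
    have he := abs_eulerFactor_le hm h0 h1
    have hmb : |m * besselFactor m (κ * r ^ 2)| ≤ m * 2 := by
      rw [abs_mul, abs_of_nonneg hm]
      gcongr
    have hκm : 0 ≤ κ * (m + 1) ^ 2 := by positivity
    constructor
    · have t1 : |eulerFactor m (κ * r ^ 2) * (Real.cos (θ - ψ) * Real.cos (m * θ))| ≤
          (2 * m + 1) * (1 * 1) := by
        rw [abs_mul, abs_mul]; gcongr
      have t2 : |m * besselFactor m (κ * r ^ 2) * (Real.sin (θ - ψ) * Real.sin (m * θ))| ≤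
          (m * 2) * (1 * 1) := by
        rw [abs_mul, abs_mul (Real.sin _)]; gcongr
      refine (abs_add_le _ _).trans ((add_le_add t1 t2).trans ?_)
      nlinarith
    · have t1 : |eulerFactor m (κ * r ^ 2) * (-Real.sin (θ - ψ) * Real.cos (m * θ) -
          Real.cos (θ - ψ) * (Real.sin (m * θ) * m))| ≤ (2 * m + 1) * (1 * 1 + 1 * (1 * m)) := by
        rw [abs_mul]
        gcongr
        refine (abs_sub _ _).trans ?_
        rw [abs_mul, abs_mul, abs_mul, abs_neg, abs_of_nonneg hm]
        gcongr
      have t2 : |m * besselFactor m (κ * r ^ 2) * (Real.cos (θ - ψ) * Real.sin (m * θ) +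
          Real.sin (θ - ψ) * (Real.cos (m * θ) * m))| ≤ (m * 2) * (1 * 1 + 1 * (1 * m)) := by
        rw [abs_mul]
        gcongr
        refine (abs_add_le _ _).trans ?_
        rw [abs_mul, abs_mul (Real.sin _), abs_mul (Real.cos _) m, abs_of_nonneg hm]
        gcongr
      refine (abs_add_le _ _).trans ((add_le_add t1 t2).trans ?_)
      nlinarith

lemma summable_modeBound {A : ℕ → ℝ} {K R κ ν ρ : ℝ} (hν : 0 < ν) (hρ : 0 < ρ) (hρR : ρ < R)
    (hA : ∀ n : ℕ, |A n| * R ^ (n * ν) ≤ K) :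
    Summable fun n : ℕ => |A n| * ρ ^ modeExp ν n * modeBound κ ν n := by
  have h := (summable_coeff hν hρ hρR hA).mul_left (4 * κ + 4)
  rw [← summable_nat_add_iff 1] at h ⊢
  refine h.congr fun n => ?_
  simp only [modeExp, modeBound, Nat.add_eq_zero_iff, one_ne_zero, and_false, if_false]
  ring

lemma modeProfile_zero {κ ν ψ θ : ℝ} {n : ℕ} (hν : 0 < ν) (hn : n ≠ 0) :
    modeProfile κ ν ψ n 0 θ = n * ν * Real.cos ((n * ν - 1) * θ + ψ) := by
  have hm : 0 ≤ (n : ℝ) * ν := by positivity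
  have e : ((n : ℝ) * ν - 1) * θ + ψ = n * ν * θ - (θ - ψ) := by ring
  simp only [modeProfile, hn, if_false, modeDeriv, eulerFactor, e, Real.cos_sub (n * ν * θ)]
  simp only [ne_eq, OfNat.ofNat_ne_zero, not_false_eq_true, zero_pow, mul_zero,
    besselFactor_zero hm]
  ring

lemma modeProfileDeriv_zero {κ ν ψ θ : ℝ} {n : ℕ} (hν : 0 < ν) (hn : n ≠ 0) :
    modeProfileDeriv κ ν ψ n 0 θ =
      -(n * ν * (n * ν - 1) * Real.sin ((n * ν - 1) * θ + ψ)) := by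
  have hm : 0 ≤ (n : ℝ) * ν := by positivity
  have e : ((n : ℝ) * ν - 1) * θ + ψ = n * ν * θ - (θ - ψ) := by ring
  simp only [modeProfileDeriv, hn, if_false, eulerFactor, e, Real.sin_sub (n * ν * θ)]
  simp only [ne_eq, OfNat.ofNat_ne_zero, not_false_eq_true, zero_pow, mul_zero,
    besselFactor_zero hm]
  ring

lemma modeProfile_zero_zero (κ ν ψ θ : ℝ) :
    modeProfile κ ν ψ 0 0 θ = -(2 * κ) * Real.cos (θ - ψ) := by
  simp [modeProfile, besselFactor_zero]

lemma modeProfileDeriv_zero_zero (κ ν ψ θ : ℝ) :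
    modeProfileDeriv κ ν ψ 0 0 θ = 2 * κ * Real.sin (θ - ψ) := by
  simp [modeProfileDeriv, besselFactor_zero]

lemma exists_zero_curve_of_pos {h h' : ℝ × ℝ → ℝ} {ρ β θ₀ : ℝ} (hρ : 0 < ρ)
    (hc : ContinuousOn h (Icc 0 ρ ×ˢ univ)) (hc' : ContinuousOn h' (Icc 0 ρ ×ˢ univ))
    (hd : ∀ r ∈ Icc 0 ρ, ∀ θ, HasDerivAt (fun θ => h (r, θ)) (h' (r, θ)) θ)
    (h0 : h (0, θ₀) = 0) (h0' : 0 < h' (0, θ₀)) (hθ : θ₀ ∈ Ioo 0 β) :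
    ∃ ε ∈ Ioc 0 ρ, ∃ g : ℝ → ℝ, ContinuousOn g (Icc 0 ε) ∧
      ∀ r ∈ Icc 0 ε, g r ∈ Ioo 0 β ∧ h (r, g r) = 0 := by
  have hmem : ∀ θ : ℝ, ((0 : ℝ), θ) ∈ Icc 0 ρ ×ˢ (univ : Set ℝ) := fun θ => ⟨⟨le_rfl, hρ.le⟩, trivial⟩
  have hev := (hc' _ (hmem θ₀)).eventually (lt_mem_nhds h0')
  rw [nhdsWithin_prod_eq, nhdsWithin_univ] at hev
  obtain ⟨p, hp, q, hq, hpq⟩ := Filter.eventually_prod_iff.1 hev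
  obtain ⟨δ, hδ, hδq⟩ : ∃ δ > 0, ∀ θ ∈ Icc (θ₀ - δ) (θ₀ + δ), q θ ∧ θ ∈ Ioo 0 β := by
    have := hq.and (Ioo_mem_nhds hθ.1 hθ.2)
    obtain ⟨δ, hδ, hδq⟩ := Metric.nhds_basis_closedBall.eventually_iff.1 this
    exact ⟨δ, hδ, fun θ hθ => hδq (by rwa [Real.closedBall_eq_Icc])⟩
  have hsl : ∀ θ : ℝ, ContinuousOn (fun r => h (r, θ)) (Icc 0 ρ) := fun θ =>
    hc.comp (by fun_prop) fun r hr => ⟨hr, trivial⟩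
  have mono : ∀ r ∈ Icc 0 ρ, p r → StrictMonoOn (fun θ => h (r, θ)) (Icc (θ₀ - δ) (θ₀ + δ)) := by
    intro r hr hpr
    refine strictMonoOn_of_deriv_pos (convex_Icc _ _)
      (fun θ _ => (hd r hr θ).continuousAt.continuousWithinAt) fun θ hθ => ?_
    rw [(hd r hr θ).deriv]
    exact hpq hpr (hδq θ (interior_subset hθ)).1
  have hm₀ : θ₀ ∈ Icc (θ₀ - δ) (θ₀ + δ) := ⟨by linarith, by linarith⟩
  have hm₁ : θ₀ - δ ∈ Icc (θ₀ - δ) (θ₀ + δ) := ⟨le_rfl, by linarith⟩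
  have hm₂ : θ₀ + δ ∈ Icc (θ₀ - δ) (θ₀ + δ) := ⟨by linarith, le_rfl⟩
  have hr0 : (0 : ℝ) ∈ Icc 0 ρ := ⟨le_rfl, hρ.le⟩
  have mono0 := mono 0 hr0 (hp.self_of_nhdsWithin hr0)
  have hlo : h (0, θ₀ - δ) < 0 := by
    simpa [h0] using mono0 hm₁ hm₀ (by linarith)
  have hhi : 0 < h (0, θ₀ + δ) := by
    simpa [h0] using mono0 hm₀ hm₂ (by linarith)
  have hev2 := hp.and (((hsl (θ₀ - δ) 0 hr0).eventually (gt_mem_nhds hlo)).and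
    ((hsl (θ₀ + δ) 0 hr0).eventually (lt_mem_nhds hhi)))
  obtain ⟨ε, hε, hεp⟩ : ∃ ε ∈ Ioc 0 ρ, ∀ r ∈ Icc 0 ε,
      p r ∧ h (r, θ₀ - δ) < 0 ∧ 0 < h (r, θ₀ + δ) := by
    obtain ⟨ε, hε, hball⟩ := Metric.nhdsWithin_basis_ball.eventually_iff.1 hev2
    refine ⟨min (ε / 2) ρ, ⟨by positivity, min_le_right _ _⟩, fun r hr => hball ⟨?_, hr.1, ?_⟩⟩
    · rw [Metric.mem_ball, Real.dist_0_eq_abs, abs_of_nonneg hr.1]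
      have := hr.2.trans (min_le_left _ _)
      linarith
    · exact hr.2.trans (min_le_right _ _)
  have hsub : Icc 0 ε ⊆ Icc 0 ρ := Icc_subset_Icc_right hε.2
  have hex : ∀ r ∈ Icc 0 ε, ∃ θ ∈ Icc (θ₀ - δ) (θ₀ + δ), h (r, θ) = 0 := fun r hr => by
    obtain ⟨-, h1, h2⟩ := hεp r hr
    exact intermediate_value_Icc (by linarith)
      (fun θ _ => (hd r (hsub hr) θ).continuousAt.continuousWithinAt) ⟨h1.le, h2.le⟩
  choose! g hg hg0 using hex
  refine ⟨ε, hε, g, fun r₀ hr₀ => tendsto_order.2 ⟨fun a ha => ?_, fun a ha => ?_⟩,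
    fun r hr => ⟨(hδq _ (hg r hr)).2, hg0 r hr⟩⟩
  · obtain ⟨hp₀, h1, -⟩ := hεp r₀ hr₀
    have hm := mono r₀ (hsub hr₀) hp₀
    have hlt : θ₀ - δ < g r₀ := (hm.lt_iff_lt hm₁ (hg r₀ hr₀)).1 (by simpa [hg0 r₀ hr₀] using h1)
    set a' := max a (θ₀ - δ)
    have ha' : a' < g r₀ := max_lt ha hlt
    have ham : a' ∈ Icc (θ₀ - δ) (θ₀ + δ) := ⟨le_max_right _ _, ha'.le.trans (hg r₀ hr₀).2⟩
    have hneg : h (r₀, a') < 0 := hg0 r₀ hr₀ ▸ hm ham (hg r₀ hr₀) ha'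
    filter_upwards [((hsl a').mono hsub r₀ hr₀).eventually (gt_mem_nhds hneg),
      self_mem_nhdsWithin] with r hr1 hr2
    refine (le_max_left a (θ₀ - δ)).trans_lt
      (((mono r (hsub hr2) (hεp r hr2).1).lt_iff_lt ham (hg r hr2)).1 ?_)
    simpa [hg0 r hr2] using hr1
  · obtain ⟨hp₀, -, h1⟩ := hεp r₀ hr₀
    have hm := mono r₀ (hsub hr₀) hp₀
    have hlt : g r₀ < θ₀ + δ := (hm.lt_iff_lt (hg r₀ hr₀) hm₂).1 (by simpa [hg0 r₀ hr₀] using h1)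
    set a' := min a (θ₀ + δ)
    have ha' : g r₀ < a' := lt_min ha hlt
    have ham : a' ∈ Icc (θ₀ - δ) (θ₀ + δ) := ⟨(hg r₀ hr₀).1.trans ha'.le, min_le_right _ _⟩
    have hpos : 0 < h (r₀, a') := hg0 r₀ hr₀ ▸ hm (hg r₀ hr₀) ham ha'
    filter_upwards [((hsl a').mono hsub r₀ hr₀).eventually (lt_mem_nhds hpos),
      self_mem_nhdsWithin] with r hr1 hr2
    refine lt_of_lt_of_le
      (((mono r (hsub hr2) (hεp r hr2).1).lt_iff_lt (hg r hr2) ham).1 ?_) (min_le_left a (θ₀ + δ))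
    simpa [hg0 r hr2] using hr1

lemma exists_zero_curve {h h' : ℝ × ℝ → ℝ} {ρ β θ₀ : ℝ} (hρ : 0 < ρ)
    (hc : ContinuousOn h (Icc 0 ρ ×ˢ univ)) (hc' : ContinuousOn h' (Icc 0 ρ ×ˢ univ))
    (hd : ∀ r ∈ Icc 0 ρ, ∀ θ, HasDerivAt (fun θ => h (r, θ)) (h' (r, θ)) θ)
    (h0 : h (0, θ₀) = 0) (h0' : h' (0, θ₀) ≠ 0) (hθ : θ₀ ∈ Ioo 0 β) :
    ∃ ε ∈ Ioc 0 ρ, ∃ g : ℝ → ℝ, ContinuousOn g (Icc 0 ε) ∧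
      ∀ r ∈ Icc 0 ε, g r ∈ Ioo 0 β ∧ h (r, g r) = 0 := by
  rcases h0'.lt_or_gt with hneg | hpos
  · obtain ⟨ε, hε, g, hg, hz⟩ := exists_zero_curve_of_pos (h := fun p => -h p)
      (h' := fun p => -h' p) hρ hc.neg hc'.neg (fun r hr θ => (hd r hr θ).neg)
      (by simpa using h0) (by simpa using hneg) hθ
    exact ⟨ε, hε, g, hg, fun r hr => ⟨(hz r hr).1, neg_eq_zero.1 (hz r hr).2⟩⟩
  · exact exists_zero_curve_of_pos hρ hc hc' hd h0 hpos hθ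

lemma arcEndsAtZero_of_curve {Z : Set ℂ} {ε : ℝ} (hε : 0 < ε) {g : ℝ → ℝ}
    (hg : ContinuousOn g (Icc 0 ε)) (hZ : ∀ r ∈ Ioc 0 ε, polarMap r (g r) ∈ Z) :
    ArcEndsAtZero Z := by
  have hmap : ∀ t ∈ Icc (0 : ℝ) 1, t * ε ∈ Icc 0 ε := fun t ht =>
    ⟨mul_nonneg ht.1 hε.le, mul_le_of_le_one_left hε.le ht.2⟩
  have hnorm : ∀ t ∈ Icc (0 : ℝ) 1, ‖polarMap (t * ε) (g (t * ε))‖ = t * ε := fun t ht =>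
    norm_polarMap (hmap t ht).1 _
  refine ⟨fun t => polarMap (t * ε) (g (t * ε)), ?_, fun s hs t ht hst => ?_, by simp [polarMap],
    fun t ht => ?_⟩
  · have h1 : ContinuousOn (fun t => g (t * ε)) (Icc 0 1) := hg.comp (by fun_prop) hmap
    have h2 : ContinuousOn (fun t => ((g (t * ε) : ℝ) : ℂ)) (Icc 0 1) :=
      Complex.continuous_ofReal.comp_continuousOn h1
    have h3 : ContinuousOn (fun t : ℝ => ((t * ε : ℝ) : ℂ)) (Icc 0 1) :=
      (Complex.continuous_ofReal.comp (by fun_prop)).continuousOn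
    exact h3.mul (continuousOn_const.mul h2).cexp
  · have h1 := hnorm s hs
    simp only at hst
    rw [hst, hnorm t ht] at h1
    exact (mul_right_cancel₀ hε.ne' h1).symm
  · have h0 : 0 < t * ε := mul_pos ht.1 hε
    exact ⟨hZ _ ⟨h0, (hmap t ⟨ht.1.le, ht.2⟩).2⟩, polarMap_ne_zero h0 _⟩

lemma not_arcEndsAtZero {Z : Set ℂ} {β ρ : ℝ} {h : ℝ × ℝ → ℝ} (hρ : 0 < ρ)
    (hc : ContinuousOn h (Icc 0 ρ ×ˢ univ)) (hZS : Z ⊆ closedSector β)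
    (hZ : ∀ r ∈ Ioc 0 ρ, ∀ θ ∈ Icc 0 β, polarMap r θ ∈ Z → h (r, θ) = 0)
    (h0 : ∀ θ ∈ Icc 0 β, h (0, θ) ≠ 0) : ¬ ArcEndsAtZero Z := by
  rintro ⟨γ, hγ, -, hγ0, hγZ⟩
  have hev : ∀ᶠ r in nhds 0, ∀ θ ∈ Icc 0 β, r ∈ Icc 0 ρ → h (r, θ) ≠ 0 := by
    refine isCompact_Icc.eventually_forall_of_forall_eventually fun θ hθ => ?_
    have := (hc (0, θ) ⟨⟨le_rfl, hρ.le⟩, trivial⟩).eventually (isOpen_ne.mem_nhds (h0 θ hθ))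
    filter_upwards [eventually_nhdsWithin_iff.1 this] with p hp hp1 using hp ⟨hp1, trivial⟩
  obtain ⟨ε, hε, hball⟩ := Metric.nhds_basis_ball.eventually_iff.1 hev
  have hlim := ((hγ 0 ⟨le_rfl, zero_le_one⟩).mono Ioc_subset_Icc_self).tendsto.norm
  rw [hγ0, norm_zero] at hlim
  have hne : (nhdsWithin (0 : ℝ) (Ioc 0 1)).NeBot := left_nhdsWithin_Ioc_neBot zero_lt_one
  obtain ⟨t, ht, htm⟩ := ((hlim.eventually (gt_mem_nhds (lt_min hε hρ))).and
    self_mem_nhdsWithin).exists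
  obtain ⟨htZ, ht0⟩ := hγZ t htm
  obtain ⟨r, hr, θ, hθ0, hθ1, heq⟩ := hZS htZ
  change γ t = polarMap r θ at heq
  rw [heq] at ht htZ ht0
  rw [norm_polarMap hr] at ht
  have hr0 : 0 < r := hr.lt_of_ne fun h => ht0 (by simp [← h, polarMap])
  have hrρ : r ≤ ρ := (ht.trans_le (min_le_right _ _)).le
  refine hball ?_ θ ⟨hθ0, hθ1⟩ ⟨hr, hrρ⟩ (hZ r ⟨hr0, hrρ⟩ θ ⟨hθ0, hθ1⟩ htZ)
  rw [Metric.mem_ball, Real.dist_0_eq_abs, abs_of_nonneg hr]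
  exact ht.trans_le (min_le_left _ _)

lemma exists_leading_index {A : ℕ → ℝ} {ν : ℝ} (hν : 1 < ν) (hν2 : ν ≠ 2) (hA : ∃ n, A n ≠ 0) :
    ∃ N, A N ≠ 0 ∧ ∀ n, n ≠ N → A n ≠ 0 → modeExp ν N < modeExp ν n := by
  classical
  by_cases h : ∃ n, n ≠ 0 ∧ A n ≠ 0
  · obtain ⟨k, ⟨hk0, hkA⟩, hmin⟩ : ∃ k, (k ≠ 0 ∧ A k ≠ 0) ∧ ∀ n, n ≠ 0 ∧ A n ≠ 0 → k ≤ n :=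
      ⟨Nat.find h, Nat.find_spec h, fun n hn => Nat.find_min' h hn⟩
    have hek : modeExp ν k = k * ν := if_neg hk0
    have h0 : modeExp ν 0 = 2 := if_pos rfl
    by_cases hc : A 0 = 0 ∨ k * ν < 2
    · refine ⟨k, hkA, fun n hn hAn => ?_⟩
      rcases eq_or_ne n 0 with rfl | hn0
      · rw [hek, h0]
        exact hc.resolve_left hAn
      · rw [hek, modeExp, if_neg hn0]
        have : (k : ℝ) < n := by exact_mod_cast (hmin n ⟨hn0, hAn⟩).lt_of_ne hn.symm
        gcongr
    · push Not at hc
      refine ⟨0, hc.1, fun n hn hAn => ?_⟩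
      have hkn : (k : ℝ) ≤ n := by exact_mod_cast hmin n ⟨hn, hAn⟩
      rw [h0, modeExp, if_neg hn]
      have hk2 : 2 < k * ν := by
        refine hc.2.lt_of_ne fun he => ?_
        rcases (Nat.one_le_iff_ne_zero.2 hk0).eq_or_lt with h1 | h1
        · rw [← h1] at he
          exact hν2 (by simpa using he.symm)
        · have : (2 : ℝ) ≤ k := by exact_mod_cast h1
          nlinarith
      refine hk2.trans_le ?_
      gcongr
  · push Not at h
    obtain ⟨n, hn⟩ := hA
    have hn0 : n = 0 := by_contra fun h0 => hn (h n h0)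
    exact ⟨0, hn0 ▸ hn, fun k hk hAk => absurd (h k hk) hAk⟩

lemma modeProfile_ne_zero {β κ ψ θ : ℝ} (hβ : 0 < β) (hβπ : β < Real.pi) (hβ2 : β ≠ Real.pi / 2)
    (hκ : 0 < κ) (hψ : ψ = 0 ∨ ψ = β) (hθ : θ ∈ Icc 0 β) :
    modeProfile κ (Real.pi / β) ψ (if β < Real.pi / 2 then 0 else 1) 0 θ ≠ 0 := by
  have hpi := Real.pi_pos
  have hν0 : 0 < Real.pi / β := by positivity
  split_ifs with h
  · rw [modeProfile_zero_zero]
    refine mul_ne_zero (by linarith) (Real.cos_pos_of_mem_Ioo ?_).ne'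
    rcases hψ with rfl | rfl
    · constructor <;> linarith [hθ.1, hθ.2]
    · constructor <;> linarith [hθ.1, hθ.2]
  · have h' : Real.pi / 2 < β := lt_of_le_of_ne (not_lt.1 h) hβ2.symm
    rw [modeProfile_zero hν0 one_ne_zero, Nat.cast_one, one_mul]
    refine mul_ne_zero hν0.ne' ?_
    have h1 : 0 < Real.pi / β - 1 := sub_pos.2 ((one_lt_div hβ).2 hβπ)
    have h2 : (Real.pi / β - 1) * θ ≤ Real.pi - β := by
      calc (Real.pi / β - 1) * θ ≤ (Real.pi / β - 1) * β := by
            have := hθ.2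
            gcongr
        _ = Real.pi - β := by field_simp
    have h3 := mul_nonneg h1.le hθ.1
    rcases hψ with rfl | rfl
    · exact (Real.cos_pos_of_mem_Ioo ⟨by linarith, by linarith⟩).ne'
    · exact (Real.cos_neg_of_pi_div_two_lt_of_lt (by linarith) (by linarith)).ne

lemma exists_simple_zero {β κ ψ : ℝ} (hβ : 0 < β) (hβπ : β < Real.pi) (hβ2 : β ≠ Real.pi / 2)
    (hκ : 0 < κ) (hψ : ψ = 0 ∨ ψ = β) {N : ℕ} (hN : N ≠ if β < Real.pi / 2 then 0 else 1) :
    ∃ θ ∈ Ioo 0 β, modeProfile κ (Real.pi / β) ψ N 0 θ = 0 ∧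
      modeProfileDeriv κ (Real.pi / β) ψ N 0 θ ≠ 0 := by
  have hpi := Real.pi_pos
  have hν0 : 0 < Real.pi / β := by positivity
  have hsin : ∀ {x : ℝ}, Real.cos x = 0 → Real.sin x ≠ 0 := fun {x} hx hs => by
    have := Real.sin_sq_add_cos_sq x
    rw [hx, hs] at this
    norm_num at this
  rcases eq_or_ne N 0 with rfl | hN0
  · have h : Real.pi / 2 < β := by
      refine lt_of_le_of_ne (not_lt.1 fun h => ?_) hβ2.symm
      simp [h] at hN
    obtain ⟨θ, hθ, hc⟩ : ∃ θ ∈ Ioo 0 β, Real.cos (θ - ψ) = 0 := by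
      rcases hψ with rfl | rfl
      · exact ⟨Real.pi / 2, ⟨by linarith, h⟩, by simp⟩
      · refine ⟨ψ - Real.pi / 2, ⟨by linarith, by linarith⟩, ?_⟩
        rw [sub_sub_cancel_left, Real.cos_neg, Real.cos_pi_div_two]
    refine ⟨θ, hθ, ?_, ?_⟩
    · rw [modeProfile_zero_zero, hc, mul_zero]
    · rw [modeProfileDeriv_zero_zero]
      exact mul_ne_zero (by positivity) (hsin hc)
  · have hN1 : (1 : ℝ) ≤ N := by exact_mod_cast Nat.one_le_iff_ne_zero.2 hN0
    set m := (N : ℝ) * (Real.pi / β) with hm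
    have hmβ : m * β = N * Real.pi := by rw [hm]; field_simp
    have hm1 : 0 < m - 1 := by
      have h1 : 1 < Real.pi / β := (one_lt_div hβ).2 hβπ
      nlinarith
    obtain ⟨c, hc0, hc1, hc⟩ : ∃ c, 0 < c ∧ c < N * Real.pi - β ∧ Real.cos (c + ψ) = 0 := by
      by_cases h : β < Real.pi / 2
      · rcases hψ with rfl | rfl
        · exact ⟨Real.pi / 2, by positivity, by nlinarith, by simp⟩
        · exact ⟨Real.pi / 2 - ψ, by linarith, by nlinarith, by simp⟩
      · have hN2 : (2 : ℝ) ≤ N := by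
          rw [if_neg h] at hN
          exact_mod_cast (by omega : 2 ≤ N)
        rcases hψ with rfl | rfl
        · exact ⟨Real.pi / 2, by positivity, by nlinarith, by simp⟩
        · refine ⟨Real.pi + Real.pi / 2 - ψ, by linarith, by nlinarith, ?_⟩
          rw [sub_add_cancel, add_comm, Real.cos_add_pi, Real.cos_pi_div_two, neg_zero]
    have hmc : (m - 1) * (c / (m - 1)) = c := mul_div_cancel₀ _ hm1.ne'
    refine ⟨c / (m - 1), ⟨by positivity, ?_⟩, ?_, ?_⟩
    · rw [div_lt_iff₀ hm1]
      linarith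
    · rw [modeProfile_zero hν0 hN0, ← hm, hmc, hc, mul_zero]
    · rw [modeProfileDeriv_zero hν0 hN0, ← hm, hmc]
      exact neg_ne_zero.2 (mul_ne_zero (mul_ne_zero (by linarith) hm1.ne') (hsin hc))

lemma tendsto_mul_besselJ {μ ν : ℝ} (hμ : 0 < μ) (hν : 0 < ν) :
    ∃ d : ℝ, d ≠ 0 ∧ Tendsto (fun r => 2 * besselJ ν (Real.sqrt μ * r) / r ^ ν)
      (nhdsWithin 0 (Ioi 0)) (nhds d) := by
  have hs : 0 < Real.sqrt μ := Real.sqrt_pos.2 hμ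
  have hG : 0 < Real.Gamma (ν + 1) := Real.Gamma_pos_of_pos (by linarith)
  refine ⟨2 * ((Real.sqrt μ / 2) ^ ν / Real.Gamma (ν + 1)), by positivity, ?_⟩
  have hc : Continuous fun r : ℝ => 2 * ((Real.sqrt μ / 2) ^ ν / Real.Gamma (ν + 1)) *
      besselFactor ν ((Real.sqrt μ * r) ^ 2 / 4) :=
    continuous_const.mul ((continuous_besselFactor hν.le).comp (by fun_prop))
  have h := (hc.tendsto 0).mono_left (nhdsWithin_le_nhds (s := Ioi 0))
  simp only [mul_zero, ne_eq, OfNat.ofNat_ne_zero, not_false_eq_true, zero_pow, zero_div,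
    besselFactor_zero hν.le, mul_one] at h
  refine h.congr' ?_
  filter_upwards [self_mem_nhdsWithin] with r hr
  have hr0 : 0 < r := hr
  have hrν : r ^ ν ≠ 0 := (Real.rpow_pos_of_pos hr0 ν).ne'
  rw [besselJ_eq hν.le (mul_pos hs hr0), show Real.sqrt μ * r / 2 = Real.sqrt μ / 2 * r by ring,
    Real.mul_rpow (by positivity) hr0.le]
  field_simp

lemma second_coeff_eq_zero_iff {β μ R K c₁ : ℝ} {u : ℂ → ℝ} {A : ℕ → ℝ} (hβ : 0 < β) (hμ : 0 < μ)
    (hR0 : 0 < R) (hR : μ / 4 * R ^ 2 ≤ 1 / 4) (hA : ∀ n : ℕ, |A n| * R ^ (n * (Real.pi / β)) ≤ K)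
    (hS : ∀ r ∈ Ioo 0 R, ∀ θ ∈ Icc 0 β, HasSum (fun n : ℕ => A n *
        radialSol (μ / 4) (n * (Real.pi / β)) r * Real.cos (n * (Real.pi / β) * θ))
        (u (polarMap r θ)))
    (hc : Tendsto (fun r : ℝ =>
      (u ((r : ℂ)) - u ((r : ℂ) * Complex.exp (Complex.I * (β : ℂ)))) /
        (2 * besselJ (Real.pi / β) (Real.sqrt μ * r)))
    (nhdsWithin 0 (Ioi 0)) (nhds c₁)) : c₁ = 0 ↔ A 1 = 0 := by
  have hpi := Real.pi_pos
  set ν := Real.pi / β with hν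
  have hν0 : 0 < ν := by positivity
  obtain ⟨d, hd0, hd⟩ := tendsto_mul_besselJ hμ hν0
  obtain ⟨ρ, hρ, hρR⟩ := exists_between hR0
  set B : ℕ → ℝ := fun n => A n * (1 - (-1) ^ n) with hB
  have hBA : ∀ n, |B n| ≤ 2 * |A n| := fun n => by
    rw [hB]
    simp only
    rw [abs_mul, mul_comm]
    gcongr
    rcases neg_one_pow_eq_or ℝ n with h | h <;> rw [h] <;> norm_num
  have hN : ∀ n : ℕ, n ≠ 1 → B n ≠ 0 → ((1 : ℕ) : ℝ) * ν < n * ν := fun n hn hBn => by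
    have h0 : n ≠ 0 := by
      rintro rfl
      simp [hB] at hBn
    have : 1 < n := by omega
    gcongr
  have hs : Summable fun n : ℕ => |B n| * ρ ^ (n * ν) * 2 := by
    refine Summable.of_nonneg_of_le (fun n => by positivity) (fun n => ?_)
      ((summable_coeff hν0 hρ hρR hA).mul_left 4)
    have h1 : (1 : ℝ) ≤ (n * ν + 1) ^ 2 := by
      have : 0 ≤ (n : ℝ) * ν := by positivity
      nlinarith
    calc |B n| * ρ ^ (n * ν) * 2 ≤ 2 * |A n| * ρ ^ (n * ν) * 2 := by
          gcongr
          exact hBA n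
      _ = 4 * (|A n| * ρ ^ (n * ν) * 1) := by ring
      _ ≤ _ := by gcongr
  have hcont := continuousOn_leading (τ := fun n r _ => besselFactor (n * ν) (μ / 4 * r ^ 2)) hρ hN hs
    (fun n r hr _ => by
      refine abs_besselFactor_le_two (by positivity) (by positivity) (le_trans ?_ hR)
      have h1 := hr.1
      have h2 := hr.2.trans hρR.le
      gcongr)
    (fun n => (continuous_besselFactor (by positivity)).comp (by fun_prop))
  have hlim := (hcont.comp (f := fun r : ℝ => (r, (0 : ℝ))) (s := Icc 0 ρ) (by fun_prop)
    (fun r hr => ⟨hr, trivial⟩) 0 ⟨le_rfl, hρ.le⟩).tendsto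
  simp only [Function.comp_def] at hlim
  rw [tsum_leading_zero hN] at hlim
  simp only [ne_eq, OfNat.ofNat_ne_zero, not_false_eq_true, zero_pow, mul_zero] at hlim
  rw [besselFactor_zero (by positivity), mul_one] at hlim
  have hlim2 : Tendsto (fun r : ℝ => (u (r : ℂ) - u ((r : ℂ) * Complex.exp (Complex.I * (β : ℂ)))) / r ^ ν)
      (nhdsWithin 0 (Ioi 0)) (nhds (B 1)) := by
    have hle : nhdsWithin (0 : ℝ) (Ioi 0) ≤ nhdsWithin 0 (Icc 0 ρ) :=
      nhdsWithin_le_iff.2 (mem_of_superset (Ioc_mem_nhdsGT hρ) Ioc_subset_Icc_self)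
    refine (hlim.mono_left hle).congr' ?_
    filter_upwards [Ioc_mem_nhdsGT hρ] with r hr
    have hrR : r ∈ Ioo 0 R := ⟨hr.1, hr.2.trans_lt hρR⟩
    have h1 := hS r hrR 0 ⟨le_rfl, hβ.le⟩
    have h2 := hS r hrR β ⟨hβ.le, le_rfl⟩
    have h3 := (h1.sub h2).div_const (r ^ ν)
    have e0 : polarMap r 0 = (r : ℂ) := by simp [polarMap]
    rw [e0] at h3
    rw [← show u (polarMap r β) = u ((r : ℂ) * Complex.exp (Complex.I * (β : ℂ))) from rfl]
    refine (h3.congr_fun fun n => ?_).tsum_eq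
    have hc1 : Real.cos (n * ν * β) = (-1) ^ n := by
      rw [hν, mul_assoc, div_mul_cancel₀ _ hβ.ne', Real.cos_nat_mul_pi]
    rw [hc1, mul_zero, Real.cos_zero, radialSol, Real.rpow_sub hr.1, Nat.cast_one, one_mul]
    ring
  have hq := hlim2.div hd hd0
  have hc2 := hc.congr' (f₂ := fun r : ℝ =>
      (u (r : ℂ) - u ((r : ℂ) * Complex.exp (Complex.I * (β : ℂ)))) / r ^ ν /
        (2 * besselJ ν (Real.sqrt μ * r) / r ^ ν)) (by
    filter_upwards [self_mem_nhdsWithin] with r hr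
    rw [div_div_div_cancel_right₀ (Real.rpow_pos_of_pos hr ν).ne'])
  rw [tendsto_nhds_unique hc2 hq, div_eq_zero_iff, or_iff_left hd0, hB]
  simp

/-- for `L_ψ` parallel to a boundary ray of the sector (`ψ ∈ {0, β}`),
the leading Bessel coefficient (`c₀` if `β < π/2`, `c₁` if `β > π/2`) vanishes
iff some arc of `Z(L_ψ u)` ends at the vertex `0`. -/
theorem stmt4 (β μ c₀ c₁ : ℝ) (u : ℂ → ℝ)
    (hu : IsSectorNeumannEigenfun β u μ) (hμ : 0 < μ)
    (hc : HasBesselCoeffs β u μ c₀ c₁)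
    (hnz : ¬ ∀ z ∈ closedSector β, u z = 0)
    (hβ₀ : 0 < β) (hβπ : β < Real.pi) (hβhalf : β ≠ Real.pi / 2)
    (ψ : ℝ) (hψ : ψ = 0 ∨ ψ = β) :
    (if β < Real.pi / 2 then c₀ else c₁) = 0 ↔
      ArcEndsAtZero {z ∈ closedSector β | Lpsi β u ψ z = 0} := by
  obtain ⟨R, K, A, hR0, hR, hA, hS, hA0, hAz⟩ := exists_expansion hβ₀ hβπ hμ hu
  have hex : ∃ n, A n ≠ 0 := by
    by_contra! h
    exact hnz (hAz h)
  have hν : 1 < Real.pi / β := (one_lt_div hβ₀).2 hβπ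
  have hν2 : Real.pi / β ≠ 2 := fun h => hβhalf (by field_simp at h; linarith)
  obtain ⟨N, hAN, hN⟩ := exists_leading_index hν hν2 hex
  have hc1 := second_coeff_eq_zero_iff hβ₀ hμ hR0 hR hA hS hc.2
  have hν0 : 0 < Real.pi / β := by positivity
  have hlead : (if β < Real.pi / 2 then c₀ else c₁) = 0 ↔
      N ≠ (if β < Real.pi / 2 then 0 else 1) := by
    have hlt : ∀ n, A n ≠ 0 → N ≠ n → modeExp (Real.pi / β) N < modeExp (Real.pi / β) n :=
      fun n h1 h2 => hN n h2.symm h1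
    have hcast : N ≠ 0 → (1 : ℝ) ≤ N := fun h => by exact_mod_cast Nat.one_le_iff_ne_zero.2 h
    split_ifs with hβ2
    · rw [← hc.1, ← hA0]
      refine ⟨fun h => ?_, fun h => ?_⟩
      · rintro rfl
        exact hAN h
      · by_contra h0
        have := hlt 0 h0 h
        have h2 : 2 < Real.pi / β := by rw [lt_div_iff₀ hβ₀]; linarith
        simp only [modeExp, h, if_false, if_true] at this
        nlinarith [hcast h]
    · rw [hc1]
      refine ⟨fun h => ?_, fun h => ?_⟩
      · rintro rfl
        exact hAN h
      · by_contra h0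
        have := hlt 1 h0 h
        have h2 : Real.pi / β ≤ 2 := by rw [div_le_iff₀ hβ₀]; linarith
        by_cases hN0 : N = 0
        · simp only [modeExp, hN0, one_ne_zero, if_false, if_true, Nat.cast_one] at this
          linarith
        · simp only [modeExp, hN0, one_ne_zero, if_false, Nat.cast_one] at this
          nlinarith [hcast hN0]
  rw [hlead]
  obtain ⟨ρ, hρ, hρR⟩ := exists_between hR0
  have hκ : 0 < μ / 4 := by positivity
  have hκρ : μ / 4 * ρ ^ 2 ≤ 1 / 4 := le_trans (by gcongr) hR
  have hs := summable_modeBound (κ := μ / 4) hν0 hρ hρR hA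
  have hb := fun n r (hr : r ∈ Icc 0 ρ) θ => (abs_modeProfile_le (ψ := ψ) hκ hν0 hκρ n hr θ).1
  have hb' := fun n r (hr : r ∈ Icc 0 ρ) θ => (abs_modeProfile_le (ψ := ψ) hκ hν0 hκρ n hr θ).2
  have hcont := continuousOn_leading hρ hN hs hb (continuous_modeProfile hν0)
  have hcont' := continuousOn_leading hρ hN hs hb' (continuous_modeProfileDeriv hν0)
  set h : ℝ × ℝ → ℝ := fun p => ∑' n, A n *
    p.1 ^ (modeExp (Real.pi / β) n - modeExp (Real.pi / β) N) *
      modeProfile (μ / 4) (Real.pi / β) ψ n p.1 p.2 with hh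
  have hzero : ∀ θ, h (0, θ) = A N * modeProfile (μ / 4) (Real.pi / β) ψ N 0 θ := fun θ =>
    tsum_leading_zero hN fun n => modeProfile (μ / 4) (Real.pi / β) ψ n 0 θ
  have hiff : ∀ r ∈ Ioc 0 ρ, ∀ θ ∈ Icc 0 β, Lpsi β u ψ (polarMap r θ) = 0 ↔ h (r, θ) = 0 := by
    intro r hr θ hθ
    have hsum := (hasSum_mul_Lpsi hβ₀ hμ hu hR hA hS ψ ⟨hr.1, hr.2.trans_lt hρR⟩ hθ).tsum_eq
    have hfac : r * Lpsi β u ψ (polarMap r θ) = r ^ modeExp (Real.pi / β) N * h (r, θ) := by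
      rw [← hsum, hh, ← tsum_mul_left]
      refine tsum_congr fun n => ?_
      rw [mul_assoc, rpow_mul_modeDeriv, Real.rpow_sub hr.1]
      have := (Real.rpow_pos_of_pos hr.1 (modeExp (Real.pi / β) N)).ne'
      field_simp
    have hrN := (Real.rpow_pos_of_pos hr.1 (modeExp (Real.pi / β) N)).ne'
    simpa [hr.1.ne', hrN] using congrArg (· = 0) hfac
  constructor
  · intro hNl
    obtain ⟨θ, hθ, hz, hz'⟩ := exists_simple_zero hβ₀ hβπ hβhalf hκ hψ hNl
    obtain ⟨ε, hε, g, hg, hgz⟩ := exists_zero_curve hρ hcont hcont'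
      (fun r hr θ => hasDerivAt_leading hρ hN hs hb hb' (hasDerivAt_modeProfile _ _ ψ) hr θ)
      (by rw [hzero, hz, mul_zero])
      (by
        simp only
        rw [tsum_leading_zero hN fun n => modeProfileDeriv (μ / 4) (Real.pi / β) ψ n 0 θ]
        exact mul_ne_zero hAN hz') hθ
    refine arcEndsAtZero_of_curve hε.1 hg fun r hr => ?_
    obtain ⟨h1, h2⟩ := hgz r ⟨hr.1.le, hr.2⟩
    have h3 := Ioo_subset_Icc_self h1
    exact ⟨polarMap_mem hr.1.le h3, (hiff r ⟨hr.1, hr.2.trans hε.2⟩ _ h3).2 h2⟩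
  · rintro harc rfl
    refine not_arcEndsAtZero hρ hcont (fun z hz => hz.1)
      (fun r hr θ hθ hz => (hiff r hr θ hθ).1 hz.2) (fun θ hθ => ?_) harc
    rw [hzero]
    exact mul_ne_zero hAN (modeProfile_ne_zero hβ₀ hβπ hβhalf hκ hψ hθ)

end
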